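/- arXiv:2007.08358 — 2 statements merged into one kernel-verified Lean document; each statement's English description precedes it below -/
import Mathlib

section
/- Let K be a number field of degree 11 over ℚ, and let L be a real number with |disc(K)| ≤ L. Then the regulator of K satisfies Reg(K) < 4L. In particular, Reg(K) < 4·|disc(K)|. -/
open Ideal NumberField in
theorem card_primesOver_le_finrank (K : Type*) [Field K] [NumberField K] (p : Ideal ℤ)
    [p.IsPrime] [Fintype (p.primesOver (𝓞 K))] :
    Fintype.card (p.primesOver (𝓞 K)) ≤ Module.finrank ℚ K := by
  rw [← RingOfIntegers.rank K, ← sum_ramification_inertia_eq_finrank p (𝓞 K), ← Finset.card_univ,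
    Finset.card_eq_sum_ones]
  refine Finset.sum_le_sum fun q _ ↦ ?_
  have := q.2.1
  exact Nat.mul_pos (ramificationIdx_pos _ _) (inertiaDeg_pos _ _)

open Ideal NumberField in
theorem exists_fin_index_injOn_primes (K : Type*) [Field K] [NumberField K] :
    ∃ g : Ideal (𝓞 K) → Fin (Module.finrank ℚ K), ∀ P Q : Ideal (𝓞 K), Prime P → Prime Q →
      under ℤ P = under ℤ Q → g P = g Q → P = Q := by
  have : Nonempty (Fin (Module.finrank ℚ K)) := ⟨0, Module.finrank_pos⟩
  have key (p : Ideal ℤ) : ∃ f : Ideal (𝓞 K) → Fin (Module.finrank ℚ K),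
      p.IsPrime → p ≠ ⊥ → Set.InjOn f (p.primesOver (𝓞 K)) := by
    by_cases hp : p.IsPrime ∧ p ≠ ⊥
    · obtain ⟨hp, hp0⟩ := hp
      have := hp.isMaximal hp0
      have hfin : (p.primesOver (𝓞 K)).Finite := IsDedekindDomain.primesOver_finite p (𝓞 K)
      have := hfin.fintype
      obtain ⟨f, -, hf⟩ := hfin.exists_injOn_of_encard_le
        (t := (Set.univ : Set (Fin (Module.finrank ℚ K)))) (by
          rw [Set.encard_univ, ENat.card_eq_coe_fintype_card, Fintype.card_fin,
            ← Set.coe_fintypeCard]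
          exact_mod_cast card_primesOver_le_finrank K p)
      exact ⟨f, fun _ _ ↦ hf⟩
    · exact ⟨fun _ ↦ Classical.arbitrary _, fun h h' ↦ (hp ⟨h, h'⟩).elim⟩
  choose f hf using key
  refine ⟨fun P ↦ f (under ℤ P) P, fun P Q hP hQ h hPQ ↦ ?_⟩
  have := isPrime_of_prime hP
  have := isPrime_of_prime hQ
  have h0 : under ℤ P ≠ ⊥ := fun h0 ↦ hP.ne_zero (eq_bot_of_comap_eq_bot h0)
  simp only [← h] at hPQ
  exact hf (under ℤ P) inferInstance h0 ⟨inferInstance, ⟨rfl⟩⟩ ⟨inferInstance, ⟨h⟩⟩ hPQ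

theorem Multiset.prod_prod_map_filter_eq {α ι M : Type*} [Fintype ι] [DecidableEq ι]
    [CommMonoid M] (s : Multiset α) (g : α → ι) (f : α → M) :
    ∏ i, ((s.filter fun a ↦ g a = i).map f).prod = (s.map f).prod := by
  induction s using Multiset.induction with
  | empty => simp
  | cons a s ih =>
    rw [map_cons, prod_cons, ← ih, ← Fintype.prod_ite_eq (g a) fun _ ↦ f a,
      ← Finset.prod_mul_distrib]
    refine Finset.prod_congr rfl fun i _ ↦ ?_
    by_cases h : g a = i <;> simp [h]

open Ideal UniqueFactorizationMonoid NumberField in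
/-- The ideals of `𝓞 K` embed into the tuples of natural numbers indexed by the degree of `K`,
in such a way that the product of the tuple is bounded by the norm of the ideal. -/
theorem exists_injOn_prod_le_absNorm (K : Type*) [Field K] [NumberField K] :
    ∃ φ : Ideal (𝓞 K) → Fin (Module.finrank ℚ K) → ℕ, Set.InjOn φ {I | I ≠ ⊥} ∧
      ∀ I ≠ ⊥, (∀ i, φ I i ≠ 0) ∧ ∏ i, φ I i ≤ absNorm I := by
  classical
  obtain ⟨g, hg⟩ := exists_fin_index_injOn_primes K
  let q : Ideal (𝓞 K) → ℕ := fun P ↦ absNorm (under ℤ P)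
  have hq {P : Ideal (𝓞 K)} (hP : Prime P) : (q P).Prime := by
    have := isPrime_of_prime hP
    have : NeZero P := ⟨hP.ne_zero⟩
    exact Nat.absNorm_under_prime P
  have hqinj {P Q : Ideal (𝓞 K)} (h : q P = q Q) : under ℤ P = under ℤ Q := by
    rw [← Int.ideal_span_absNorm_eq_self (under ℤ P), ← Int.ideal_span_absNorm_eq_self (under ℤ Q)]
    exact congrArg (fun n : ℕ ↦ span {(n : ℤ)}) h
  let φ : Ideal (𝓞 K) → Fin (Module.finrank ℚ K) → ℕ :=
    fun I i ↦ (((normalizedFactors I).filter fun P ↦ g P = i).map q).prod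
  have hfac (I : Ideal (𝓞 K)) (i) : ∀ n ∈ ((normalizedFactors I).filter fun P ↦ g P = i).map q,
      n.Prime := by
    intro n hn
    obtain ⟨P, hP, rfl⟩ := Multiset.mem_map.1 hn
    exact hq (prime_of_normalized_factor P (Multiset.mem_of_mem_filter hP))
  have hcount (I : Ideal (𝓞 K)) {P : Ideal (𝓞 K)} (hP : Prime P) :
      (normalizedFactors I).count P = (normalizedFactors (φ I (g P))).count (q P) := by
    rw [normalizedFactors_prod_of_prime fun n hn ↦ (hfac I _ n hn).prime, Multiset.count_map,
      Multiset.filter_filter, Multiset.count, Multiset.countP_eq_card_filter]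
    congr 1
    refine Multiset.filter_congr fun Q hQ ↦ ⟨fun h ↦ h ▸ ⟨rfl, rfl⟩, fun h ↦ ?_⟩
    exact hg P Q hP (prime_of_normalized_factor Q hQ) (hqinj h.1) h.2.symm
  refine ⟨φ, fun I hI J hJ h ↦ ?_, fun I hI ↦ ⟨fun i ↦ ?_, ?_⟩⟩
  · have : normalizedFactors I = normalizedFactors J := by
      ext P
      by_cases hP : Prime P
      · rw [hcount I hP, hcount J hP, h]
      · rw [Multiset.count_eq_zero_of_notMem fun h ↦ hP (prime_of_normalized_factor P h),
          Multiset.count_eq_zero_of_notMem fun h ↦ hP (prime_of_normalized_factor P h)]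
    rw [← Ideal.prod_normalizedFactors_eq_self hI, ← Ideal.prod_normalizedFactors_eq_self hJ, this]
  · exact Multiset.prod_ne_zero fun h ↦ (hfac I i 0 h).ne_zero rfl
  · rw [Multiset.prod_prod_map_filter_eq]
    conv_rhs => rw [← Ideal.prod_normalizedFactors_eq_self hI, map_multiset_prod]
    refine Multiset.prod_map_le_prod_map₀ _ _ (fun _ _ ↦ Nat.zero_le _) fun P hP ↦ ?_
    exact Nat.le_of_dvd (Nat.pos_of_ne_zero (absNorm_eq_zero_iff.not.2
      (prime_of_normalized_factor P hP).ne_zero)) (Int.absNorm_under_dvd_absNorm P)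

open Ideal NumberField Real in
theorem sum_inv_absNorm_sq_le (K : Type*) [Field K] [NumberField K] (s : Finset (Ideal (𝓞 K)))
    (hs : ∀ I ∈ s, I ≠ ⊥) :
    ∑ I ∈ s, ((absNorm I : ℝ) ^ 2)⁻¹ ≤ (π ^ 2 / 6) ^ Module.finrank ℚ K := by
  classical
  obtain ⟨φ, hinj, hφ⟩ := exists_injOn_prod_le_absNorm K
  let t : Fin (Module.finrank ℚ K) → Finset ℕ := fun i ↦ s.image fun I ↦ φ I i
  calc ∑ I ∈ s, ((absNorm I : ℝ) ^ 2)⁻¹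
      ≤ ∑ I ∈ s, ∏ i, ((φ I i : ℝ) ^ 2)⁻¹ := by
        refine Finset.sum_le_sum fun I hI ↦ ?_
        obtain ⟨h0, hle⟩ := hφ I (hs I hI)
        rw [Finset.prod_inv_distrib, Finset.prod_pow, ← Nat.cast_prod]
        have : 0 < ∏ i, φ I i := Finset.prod_pos fun i _ ↦ Nat.pos_of_ne_zero (h0 i)
        gcongr
    _ = ∑ x ∈ s.image φ, ∏ i, ((x i : ℝ) ^ 2)⁻¹ :=
        (Finset.sum_image (f := fun x : Fin _ → ℕ ↦ ∏ i, ((x i : ℝ) ^ 2)⁻¹)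
          fun I hI J hJ ↦ hinj (hs I hI) (hs J hJ)).symm
    _ ≤ ∑ x ∈ Fintype.piFinset t, ∏ i, ((x i : ℝ) ^ 2)⁻¹ := by
        refine Finset.sum_le_sum_of_subset_of_nonneg (fun x hx ↦ ?_) fun _ _ _ ↦ by positivity
        obtain ⟨I, hI, rfl⟩ := Finset.mem_image.1 hx
        exact Fintype.mem_piFinset.2 fun i ↦ Finset.mem_image_of_mem _ hI
    _ = ∏ i, ∑ m ∈ t i, ((m : ℝ) ^ 2)⁻¹ :=
        (Finset.prod_univ_sum t fun _ (m : ℕ) ↦ ((m : ℝ) ^ 2)⁻¹).symm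
    _ ≤ ∏ _i : Fin (Module.finrank ℚ K), (π ^ 2 / 6) := by
        refine Finset.prod_le_prod (fun _ _ ↦ by positivity) fun i _ ↦ ?_
        simpa using sum_le_hasSum (t i) (fun _ _ ↦ by positivity) hasSum_zeta_two
    _ = (π ^ 2 / 6) ^ Module.finrank ℚ K := Fin.prod_const _ _

open MeasureTheory Set in
theorem volume_setOf_lt_and_sum_lt_le {ι : Type*} [Fintype ι] (a : ι → ℝ) (b : ℝ) :
    volume {x : ι → ℝ | (∀ i, a i < x i) ∧ ∑ i, x i < b} ≤
      ENNReal.ofReal (Real.exp (2 * (b - ∑ i, a i)) / 2 ^ Fintype.card ι) := by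
  let f : ι → ℝ → ℝ := fun i ↦ (Ioi (a i)).indicator fun t ↦ Real.exp (-2 * t)
  have hf0 (i t) : 0 ≤ f i t := indicator_nonneg (fun _ _ ↦ (Real.exp_pos _).le) t
  have hf (i) : Integrable (f i) :=
    (integrable_indicator_iff measurableSet_Ioi).2 (integrableOn_exp_mul_Ioi (by norm_num) _)
  have hint (i) : ∫ t, f i t = Real.exp (-2 * a i) / 2 := by
    rw [integral_indicator measurableSet_Ioi, integral_exp_mul_Ioi (by norm_num)]
    ring
  let F : (ι → ℝ) → ℝ := fun x ↦ Real.exp (2 * b) * ∏ i, f i (x i)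
  have hF : Integrable F := (Integrable.fintype_prod hf).const_mul _
  have hF0 (x) : 0 ≤ F x := mul_nonneg (Real.exp_pos _).le (Finset.prod_nonneg fun i _ ↦ hf0 i _)
  have hF1 : {x : ι → ℝ | (∀ i, a i < x i) ∧ ∑ i, x i < b} ⊆ {x | 1 ≤ ENNReal.ofReal (F x)} := by
    rintro x ⟨hx, hxb⟩
    have : F x = Real.exp (2 * (b - ∑ i, x i)) := by
      simp only [F, f, indicator_of_mem (mem_Ioi.2 (hx _)), ← Real.exp_sum, ← Finset.mul_sum,
        ← Real.exp_add]
      congr 1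
      ring
    rw [mem_ofPred_eq, ENNReal.one_le_ofReal, this, Real.one_le_exp_iff]
    linarith
  calc volume {x : ι → ℝ | (∀ i, a i < x i) ∧ ∑ i, x i < b}
      ≤ 1 * volume {x | 1 ≤ ENNReal.ofReal (F x)} := by
        rw [one_mul]
        exact measure_mono hF1
    _ ≤ ∫⁻ x, ENNReal.ofReal (F x) :=
        mul_meas_ge_le_lintegral₀ hF.aestronglyMeasurable.aemeasurable.ennreal_ofReal 1
    _ = ENNReal.ofReal (∫ x, F x) :=
        (ofReal_integral_eq_lintegral_ofReal hF (.of_forall hF0)).symm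
    _ = _ := by
        rw [integral_const_mul, integral_fintype_prod_volume_eq_prod]
        simp only [hint, Finset.prod_div_distrib, ← Real.exp_sum, ← Finset.mul_sum,
          Finset.prod_const, Finset.card_univ]
        rw [← mul_div_assoc, ← Real.exp_add]
        congr 3
        ring

open MeasureTheory Submodule in
theorem ZLattice.ofReal_covolume_le_measure {E : Type*} [NormedAddCommGroup E] [NormedSpace ℝ E]
    [FiniteDimensional ℝ E] [MeasurableSpace E] [BorelSpace E] (L : Submodule ℤ E)
    [DiscreteTopology L] [IsZLattice ℝ L] (μ : Measure E) [μ.IsAddHaarMeasure] (s : Set E)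
    (hs : ∀ x, ∃ l ∈ L, l + x ∈ s) :
    ENNReal.ofReal (ZLattice.covolume L μ) ≤ μ s := by
  let b := Module.Free.chooseBasis ℤ L
  have hF := ZLattice.isAddFundamentalDomain b μ
  set F := ZSpan.fundamentalDomain (b.ofZLatticeBasis ℝ)
  have : MeasurableVAdd L E := (inferInstance : MeasurableVAdd L.toAddSubgroup E)
  have : VAddInvariantMeasure L E μ := (inferInstance : VAddInvariantMeasure L.toAddSubgroup E μ)
  have : Countable L := inferInstance
  rw [ZLattice.covolume_eq_measure_fundamentalDomain L μ hF, measureReal_def]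
  refine ENNReal.ofReal_toReal_le.trans ?_
  rw [hF.measure_eq_tsum s]
  refine (measure_mono fun x hx ↦ ?_).trans (measure_iUnion_le _)
  obtain ⟨l, hl, hlx⟩ := hs x
  refine Set.mem_iUnion.2 ⟨-⟨l, hl⟩, ?_, hx⟩
  exact Set.mem_vadd_set.2 ⟨l + x, hlx, by simp [Submodule.vadd_def]⟩

open NumberField NumberField.Units NumberField.InfinitePlace NumberField.mixedEmbedding
  NumberField.Units.dirichletUnitTheorem Module

open scoped NNReal

open scoped Classical in
theorem exists_ne_zero_mult_mul_log_lt (K : Type*) [Field K] [NumberField K] (M : ℝ≥0)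
    (hM : minkowskiBound K ↑1 < convexBodyLTFactor K * M) (x : logSpace K) :
    ∃ a : 𝓞 K, a ≠ 0 ∧ (∀ w : {w : InfinitePlace K // w ≠ w₀}, mult w.1 * Real.log (w.1 a) < x w) ∧
      ∑ w, x w < Real.log M - mult (w₀ : InfinitePlace K) * Real.log (w₀ (a : K)) := by
  let f : InfinitePlace K → ℝ≥0 := fun w ↦
    if h : w ≠ w₀ then (Real.exp (x ⟨w, h⟩ / mult w)).toNNReal else 1
  have hf (w : {w : InfinitePlace K // w ≠ w₀}) : (f w : ℝ) = Real.exp (x w / mult w.1) := by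
    simp [f, w.2, Real.exp_nonneg]
  obtain ⟨g, hgf, hg⟩ := adjust_f K (f := f) (w₁ := w₀) M fun w hw ↦ by
    rw [← NNReal.coe_ne_zero, hf ⟨w, hw⟩]
    exact (Real.exp_pos _).ne'
  obtain ⟨a, ha0, ha⟩ := exists_ne_zero_mem_ringOfIntegers_lt K (f := g) (by
    rw [convexBodyLT_volume, hg]
    exact hM)
  have hpos (w : InfinitePlace K) : 0 < w (a : K) :=
    w.pos_iff.2 (RingOfIntegers.coe_ne_zero_iff.2 ha0)
  have hlog (w : InfinitePlace K) :
      mult w * Real.log (w (a : K)) < mult w * Real.log (g w) :=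
    mul_lt_mul_of_pos_left (Real.log_lt_log (hpos w) (ha w)) (Nat.cast_pos.2 mult_pos)
  have hgx (w : {w : InfinitePlace K // w ≠ w₀}) : mult w.1 * Real.log (g w) = x w := by
    rw [hgf w w.2, hf, Real.log_exp, mul_div_cancel₀ _ mult_coe_ne_zero]
  refine ⟨a, ha0, fun w ↦ (hlog w).trans_eq (hgx w), ?_⟩
  have hsum : Real.log M = ∑ w, mult w * Real.log (g w) := by
    rw [← hg, NNReal.coe_prod, Real.log_prod fun w _ ↦ ?_]
    · simp
    · exact_mod_cast pow_ne_zero _ ((hpos w).trans (ha w)).ne'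
  rw [hsum, Fintype.sum_eq_add_sum_subtype_ne _ w₀, Finset.sum_congr rfl fun w _ ↦ hgx w]
  linarith [hlog w₀]

open scoped Classical in
/-- The points of the logarithmic space at which the Minkowski box of volume parameter `M`
contains `a`. -/
def logBox (K : Type*) [Field K] [NumberField K] (M : ℝ) (a : 𝓞 K) : Set (logSpace K) :=
  {x | (∀ w : {w : InfinitePlace K // w ≠ w₀}, mult w.1 * Real.log (w.1 a) < x w) ∧
    ∑ w, x w < Real.log M - mult (w₀ : InfinitePlace K) * Real.log (w₀ (a : K))}

theorem add_mem_logBox_mul {K : Type*} [Field K] [NumberField K] {M : ℝ} {a : 𝓞 K} (ha : a ≠ 0)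
    (u : (𝓞 K)ˣ) {x : logSpace K} (hx : x ∈ logBox K M a) :
    logEmbedding K (Additive.ofMul u) + x ∈ logBox K M (a * u) := by
  classical
  have hlog (w : InfinitePlace K) : (mult w : ℝ) * Real.log (w (a * u : 𝓞 K)) =
      mult w * Real.log (w (u : K)) + mult w * Real.log (w (a : K)) := by
    rw [show ((a * u : 𝓞 K) : K) = a * (u : K) from map_mul (algebraMap _ _) _ _, map_mul,
      Real.log_mul (w.pos_iff.2 (RingOfIntegers.coe_ne_zero_iff.2 ha)).ne' (Units.pos_at_place u w).ne']
    ring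
  refine ⟨fun w ↦ ?_, ?_⟩
  · rw [hlog, Pi.add_apply, logEmbedding_component]
    gcongr
    exact hx.1 w
  · simp only [Pi.add_apply]
    rw [Finset.sum_add_distrib, sum_logEmbedding_component, hlog]
    linarith [hx.2]

open scoped Classical in
theorem volume_logBox_le {K : Type*} [Field K] [NumberField K] {M : ℝ} (hM : 0 < M) {a : 𝓞 K}
    (ha : a ≠ 0) :
    MeasureTheory.volume (logBox K M a) ≤
      ENNReal.ofReal (M ^ 2 / 2 ^ Units.rank K *
        ((Ideal.absNorm (Ideal.span {a}) : ℝ) ^ 2)⁻¹) := by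
  classical
  refine (volume_setOf_lt_and_sum_lt_le _ _).trans_eq ?_
  have hpos (w : InfinitePlace K) : 0 < w (a : K) :=
    w.pos_iff.2 (RingOfIntegers.coe_ne_zero_iff.2 ha)
  have hN : (Ideal.absNorm (Ideal.span {a}) : ℝ) = ∏ w : InfinitePlace K, w (a : K) ^ mult w := by
    rw [InfinitePlace.prod_eq_abs_norm, Ideal.absNorm_span_singleton, ← Algebra.coe_norm_int]
    simp [Nat.cast_natAbs]
  have hN0 : (0 : ℝ) < Ideal.absNorm (Ideal.span {a}) :=
    hN ▸ Finset.prod_pos fun w _ ↦ pow_pos (hpos w) _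
  have hlogN : Real.log (Ideal.absNorm (Ideal.span {a})) =
      mult (w₀ : InfinitePlace K) * Real.log (w₀ (a : K)) +
        ∑ w : {w : InfinitePlace K // w ≠ w₀}, mult w.1 * Real.log (w.1 a) := by
    rw [hN, Real.log_prod fun w _ ↦ (pow_pos (hpos w) _).ne',
      Fintype.sum_eq_add_sum_subtype_ne _ w₀]
    simp
  rw [sub_sub, ← hlogN, ← Real.log_div hM.ne' hN0.ne', mul_comm, Real.exp_mul,
    Real.exp_log (div_pos hM hN0), Real.rpow_two, Units.rank,
    show Fintype.card {w : InfinitePlace K // w ≠ w₀} = Fintype.card (InfinitePlace K) - 1 by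
      simp [Fintype.card_subtype_compl]]
  congr 1
  field_simp

open Ideal in
theorem regulator_le_of_minkowskiBound_lt (K : Type*) [Field K] [NumberField K] (M : ℝ≥0)
    (hM : minkowskiBound K ↑1 < convexBodyLTFactor K * M) :
    regulator K ≤ M ^ 2 / 2 ^ Units.rank K * (Real.pi ^ 2 / 6) ^ finrank ℚ K := by
  classical
  have hM0 : (0 : ℝ) < M := by
    refine NNReal.coe_pos.2 (pos_iff_ne_zero.2 ?_)
    rintro rfl
    simp at hM
  let J := {I : Ideal (𝓞 K) // ∃ a : 𝓞 K, a ≠ 0 ∧ span {a} = I}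
  choose gen hgen0 hgen using fun I : J ↦ I.2
  have hcover (x : logSpace K) :
      ∃ l ∈ unitLattice K, l + x ∈ ⋃ I : J, logBox K M (gen I) := by
    obtain ⟨a, ha0, ha⟩ := exists_ne_zero_mult_mul_log_lt K M hM x
    let I : J := ⟨span {a}, a, ha0, rfl⟩
    obtain ⟨u, hu⟩ := span_singleton_eq_span_singleton.1 (hgen I).symm
    refine ⟨logEmbedding K (Additive.ofMul u), Submodule.mem_map_of_mem Submodule.mem_top,
      Set.mem_iUnion.2 ⟨I, ?_⟩⟩
    rw [← hu]
    exact add_mem_logBox_mul ha0 u ha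
  have : Countable (𝓞 K) := Finsupp.Countable.of_moduleFinite (R := ℤ)
  have : Countable J := Function.Injective.countable (f := gen) fun I I' h ↦
    Subtype.ext (by rw [← hgen I, ← hgen I', h])
  have hbound : ENNReal.ofReal (regulator K) ≤
      ENNReal.ofReal (M ^ 2 / 2 ^ Units.rank K * (Real.pi ^ 2 / 6) ^ finrank ℚ K) := by
    calc ENNReal.ofReal (regulator K)
        ≤ MeasureTheory.volume (⋃ I : J, logBox K M (gen I)) :=
          ZLattice.ofReal_covolume_le_measure _ _ _ hcover
      _ ≤ ∑' I : J, MeasureTheory.volume (logBox K M (gen I)) := MeasureTheory.measure_iUnion_le _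
      _ ≤ ∑' I : J, ENNReal.ofReal (M ^ 2 / 2 ^ Units.rank K * ((absNorm I.1 : ℝ) ^ 2)⁻¹) :=
          ENNReal.tsum_le_tsum fun I ↦ by
            simpa only [hgen I] using volume_logBox_le hM0 (hgen0 I)
      _ ≤ _ := by
          rw [ENNReal.tsum_eq_iSup_sum]
          refine iSup_le fun s ↦ ?_
          rw [← ENNReal.ofReal_sum_of_nonneg fun _ _ ↦ by positivity, ← Finset.mul_sum]
          gcongr
          refine (Finset.sum_map s (Function.Embedding.subtype _)
            fun I : Ideal (𝓞 K) ↦ ((absNorm I : ℝ) ^ 2)⁻¹).symm.trans_le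
            (sum_inv_absNorm_sq_le K _ fun I hI ↦ ?_)
          obtain ⟨⟨_, a, ha, rfl⟩, -, rfl⟩ := Finset.mem_map.1 hI
          exact span_singleton_eq_bot.not.2 ha
  exact (ENNReal.ofReal_le_ofReal_iff (by positivity)).1 hbound

theorem minkowskiBound_one (K : Type*) [Field K] [NumberField K] :
    minkowskiBound K ↑1 =
      (2 ^ nrRealPlaces K * 2 ^ nrComplexPlaces K * NNReal.sqrt ‖discr K‖₊ : ℝ≥0) := by
  classical
  rw [minkowskiBound, volume_fundamentalDomain_fractionalIdealLatticeBasis, Units.val_one,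
    FractionalIdeal.absNorm_one, Rat.cast_one, ENNReal.ofReal_one, one_mul,
    mixedEmbedding.finrank, volume_fundamentalDomain_latticeBasis,
    ← card_add_two_mul_card_eq_rank]
  have : ((2 : ENNReal)⁻¹) = ((2⁻¹ : ℝ≥0) : ENNReal) := by simp
  rw [this]
  norm_cast
  push_cast
  rw [pow_add, pow_mul]
  have h : (2⁻¹ : ℝ≥0) ^ nrComplexPlaces K * (2 ^ 2) ^ nrComplexPlaces K =
      2 ^ nrComplexPlaces K := by
    rw [← mul_pow]
    norm_num
  linear_combination (2 ^ nrRealPlaces K * NNReal.sqrt ‖discr K‖₊) * h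

theorem regulator_le_mul_discr (K : Type*) [Field K] [NumberField K] :
    regulator K ≤ 4 * (4 / Real.pi ^ 2) ^ nrComplexPlaces K / 2 ^ Units.rank K *
      (Real.pi ^ 2 / 6) ^ finrank ℚ K * |(discr K : ℝ)| := by
  have hd : 0 < NNReal.sqrt ‖discr K‖₊ :=
    NNReal.sqrt_pos.2 (nnnorm_pos.2 (discr_ne_zero K))
  have h := regulator_le_of_minkowskiBound_lt K
    (2 * (2 / NNReal.pi) ^ nrComplexPlaces K * NNReal.sqrt ‖discr K‖₊) (by
      rw [minkowskiBound_one, ← ENNReal.coe_mul, ENNReal.coe_lt_coe, convexBodyLTFactor]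
      have hpi := NNReal.pi_ne_zero
      calc 2 ^ nrRealPlaces K * 2 ^ nrComplexPlaces K * NNReal.sqrt ‖discr K‖₊
          < 2 * (2 ^ nrRealPlaces K * 2 ^ nrComplexPlaces K * NNReal.sqrt ‖discr K‖₊) :=
            lt_mul_of_one_lt_left (by positivity) one_lt_two
        _ = _ := by
            rw [div_pow]
            field_simp)
  refine h.trans_eq ?_
  have hsq : (NNReal.sqrt ‖discr K‖₊ : ℝ) ^ 2 = |(discr K : ℝ)| := by
    rw [← NNReal.coe_pow, NNReal.sq_sqrt, coe_nnnorm, Int.norm_eq_abs]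
  have hpow : (4 / Real.pi ^ 2) ^ nrComplexPlaces K =
      ((2 / Real.pi) ^ nrComplexPlaces K) ^ 2 := by
    rw [← pow_mul, mul_comm, pow_mul, div_pow 2 Real.pi 2]
    norm_num
  rw [← hsq, hpow]
  push_cast
  rw [NNReal.coe_real_pi]
  ring

theorem regulator_lt_four_mul_discr (K : Type*) [Field K] [NumberField K]
    (hdeg : Module.finrank ℚ K = 11) (L : ℝ)
    (hL : |(NumberField.discr K : ℝ)| ≤ L) :
    NumberField.Units.regulator K < 4 * L ∧
      NumberField.Units.regulator K < 4 * |(NumberField.discr K : ℝ)| := by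
  suffices h : regulator K < 4 * |(discr K : ℝ)| from ⟨by linarith, h⟩
  have hd : 0 < |(discr K : ℝ)| := abs_pos.2 (Int.cast_ne_zero.2 (discr_ne_zero K))
  refine (regulator_le_mul_discr K).trans_lt (mul_lt_mul_of_pos_right ?_ hd)
  have hrank : Units.rank K + nrComplexPlaces K = 10 := by
    have h1 := card_add_two_mul_card_eq_rank K
    have h2 := card_eq_nrRealPlaces_add_nrComplexPlaces K
    rw [Units.rank]
    omega
  have hpi : Real.pi ^ 2 / 6 ≤ 5 / 3 := by
    nlinarith [Real.pi_lt_d2, Real.pi_pos]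
  have hpi' : 8 / Real.pi ^ 2 ≤ 1 := by
    rw [div_le_one (by positivity)]
    nlinarith [Real.pi_gt_three]
  have hpow : (4 / Real.pi ^ 2) ^ nrComplexPlaces K / 2 ^ Units.rank K =
      (8 / Real.pi ^ 2) ^ nrComplexPlaces K / 2 ^ 10 := by
    rw [← hrank, pow_add, show 8 / Real.pi ^ 2 = 4 / Real.pi ^ 2 * 2 by ring, mul_pow]
    field_simp
  rw [hdeg, mul_div_assoc, hpow]
  calc 4 * ((8 / Real.pi ^ 2) ^ nrComplexPlaces K / 2 ^ 10) * (Real.pi ^ 2 / 6) ^ 11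
      ≤ 4 * (1 / 2 ^ 10) * (5 / 3) ^ 11 := by
        gcongr
        exact pow_le_one₀ (by positivity) hpi'
    _ < 4 := by norm_num
end

section
/- Let (a, b) be one of the pairs (1, ±2), (4, ±1), (4, ±3), (11, ±4), (14, ±5), (6, ±5). For every n ≥ 0, if a·uₙ + b·vₙ = x^{11} for some integer x, then x = 1 or x = −1. -/
/-- The Fibonacci numbers as integers: `u₀ = 0`, `u₁ = 1`, `u_{n+2} = u_{n+1} + uₙ`. -/
def fibZ (n : ℕ) : ℤ := Nat.fib n

/-- The Lucas numbers: `v₀ = 2`, `v₁ = 1`, `v_{n+2} = v_{n+1} + vₙ`. -/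
def lucasZ : ℕ → ℤ
  | 0 => 2
  | 1 => 1
  | n + 2 => lucasZ (n + 1) + lucasZ n

/-- One step of the Fibonacci recursion modulo `Q` on pairs of consecutive terms. -/
def fibStep (Q : ℕ) (s : ℕ × ℕ) : ℕ × ℕ := (s.2, (s.1 + s.2) % Q)

/-- Whether `s` fails to be an eleventh power modulo one of the primes in `qs`. -/
def nonPower (qs : List ℕ) (s : ℕ) : Bool :=
  qs.any fun q ↦ !((s % q) ^ ((q - 1) / 11) % q == 0) && !((s % q) ^ ((q - 1) / 11) % q == 1)

/-- Run the recursion from index `i` for `fuel` steps, checking that every index is either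
congruent to `n₀` modulo `1320` or excluded by `nonPower`, and that the state returns to `s₀`. -/
def sieveRun (Q : ℕ) (qs : List ℕ) (n₀ : ℕ) (s₀ : ℕ × ℕ) : ℕ → ℕ → ℕ × ℕ → Bool
  | 0, _, s => s.1 == s₀.1 && s.2 == s₀.2
  | fuel + 1, i, s =>
    (i % 1320 == n₀ || nonPower qs s.1) && sieveRun Q qs n₀ s₀ fuel (i + 1) (fibStep Q s)

theorem sieveRun_spec {Q : ℕ} {qs : List ℕ} {n₀ : ℕ} {s₀ : ℕ × ℕ} :
    ∀ {fuel i : ℕ} {s : ℕ × ℕ}, sieveRun Q qs n₀ s₀ fuel i s = true →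
      (fibStep Q)^[fuel] s = s₀ ∧
        ∀ j < fuel, (i + j) % 1320 = n₀ ∨ nonPower qs ((fibStep Q)^[j] s).1 = true := by
  intro fuel
  induction fuel with
  | zero =>
    intro i s h
    simp only [sieveRun, Bool.and_eq_true, beq_iff_eq] at h
    exact ⟨Prod.ext h.1 h.2, fun j hj ↦ absurd hj (Nat.not_lt_zero j)⟩
  | succ fuel ih =>
    intro i s h
    simp only [sieveRun, Bool.and_eq_true, Bool.or_eq_true, beq_iff_eq] at h
    obtain ⟨h1, h2⟩ := ih h.2
    refine ⟨h1, fun j hj ↦ ?_⟩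
    rcases j with _ | j
    · exact h.1
    · have := h2 j (by omega)
      rw [show i + (j + 1) = i + 1 + j by ring]
      exact this

theorem not_nonPower_pow {qs : List ℕ} (hqs : ∀ q ∈ qs, q.Prime ∧ q % 11 = 1) {s : ℕ} {x : ℤ}
    (h : ∀ q ∈ qs, (s : ℤ) ≡ x ^ 11 [ZMOD q]) : nonPower qs s = false := by
  rw [nonPower, List.any_eq_false]
  intro q hq
  obtain ⟨hp, h11⟩ := hqs q hq
  have := Fact.mk hp
  have hs : (s : ZMod q) = (x : ZMod q) ^ 11 := by
    have := (ZMod.intCast_eq_intCast_iff _ _ q).2 (h q hq)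
    push_cast at this
    exact this
  have hk : 11 * ((q - 1) / 11) = q - 1 := by omega
  have hpow : (((s % q) ^ ((q - 1) / 11) : ℕ) : ZMod q) = (x : ZMod q) ^ (q - 1) := by
    push_cast
    rw [ZMod.natCast_mod, hs, ← pow_mul, hk]
  have h2 := hp.two_le
  simp only [Bool.and_eq_true, Bool.not_eq_true', beq_eq_false_iff_ne, ne_eq, not_and, not_not]
  intro h0
  have hx : (x : ZMod q) ≠ 0 := by
    intro hx
    apply h0
    rw [hx, zero_pow (by omega)] at hpow
    exact Nat.mod_eq_zero_of_dvd ((ZMod.natCast_eq_zero_iff _ _).1 hpow)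
  rw [ZMod.pow_card_sub_one_eq_one hx] at hpow
  have : (((s % q) ^ ((q - 1) / 11) : ℕ) : ZMod q) = ((1 : ℕ) : ZMod q) := by simpa using hpow
  rw [ZMod.natCast_eq_natCast_iff'] at this
  rw [this, Nat.mod_eq_of_lt (by omega)]

/-- The sequence `a uₙ + b vₙ`. -/
def hardSeq (a b : ℤ) (n : ℕ) : ℤ := a * fibZ n + b * lucasZ n

theorem hardSeq_add_two (a b : ℤ) (n : ℕ) :
    hardSeq a b (n + 2) = hardSeq a b (n + 1) + hardSeq a b n := by
  simp only [hardSeq, fibZ, lucasZ, Nat.fib_add_two]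
  push_cast
  ring

theorem hardSeq_zero (a b : ℤ) : hardSeq a b 0 = 2 * b := by
  simp [hardSeq, fibZ, lucasZ]; ring

theorem hardSeq_one (a b : ℤ) : hardSeq a b 1 = a + b := by
  simp [hardSeq, fibZ, lucasZ]

theorem hardSeq_modEq_iterate {Q : ℕ} {a b : ℤ} {s : ℕ × ℕ}
    (h0 : (s.1 : ℤ) ≡ 2 * b [ZMOD Q]) (h1 : (s.2 : ℤ) ≡ a + b [ZMOD Q]) (n : ℕ) :
    (((fibStep Q)^[n] s).1 : ℤ) ≡ hardSeq a b n [ZMOD Q] ∧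
      (((fibStep Q)^[n] s).2 : ℤ) ≡ hardSeq a b (n + 1) [ZMOD Q] := by
  induction n with
  | zero => simpa [hardSeq_zero, hardSeq_one] using ⟨h0, h1⟩
  | succ n ih =>
    rw [Function.iterate_succ_apply', hardSeq_add_two]
    refine ⟨ih.2, ?_⟩
    simp only [fibStep]
    push_cast
    rw [add_comm (hardSeq a b (n + 1))]
    exact (Int.mod_modEq _ _).trans (ih.1.add ih.2)

/-- If the sieve succeeds, an eleventh power can only occur at an index congruent to `n₀`
modulo `1320`. -/
theorem index_of_sieve {Q : ℕ} {qs : List ℕ} {n₀ : ℕ} {s : ℕ × ℕ} {a b : ℤ}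
    (hqs : ∀ q ∈ qs, q.Prime ∧ q % 11 = 1 ∧ q ∣ Q)
    (h0 : (s.1 : ℤ) ≡ 2 * b [ZMOD Q]) (h1 : (s.2 : ℤ) ≡ a + b [ZMOD Q])
    (hrun : sieveRun Q qs n₀ s 2640 0 s = true) {n : ℕ} {x : ℤ}
    (hx : hardSeq a b n = x ^ 11) : n % 1320 = n₀ := by
  obtain ⟨hper, hall⟩ := sieveRun_spec hrun
  have hmod : (fibStep Q)^[n] s = (fibStep Q)^[n % 2640] s :=
    (Function.IsPeriodicPt.iterate_mod_apply (n := 2640) hper n).symm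
  rcases hall (n % 2640) (Nat.mod_lt _ (by norm_num)) with h | h
  · omega
  · exfalso
    have key := (hardSeq_modEq_iterate h0 h1 n).1
    rw [hmod, hx] at key
    rw [not_nonPower_pow (fun q hq ↦ ⟨(hqs q hq).1, (hqs q hq).2.1⟩)
      (fun q hq ↦ key.of_dvd (by exact_mod_cast (hqs q hq).2.2))] at h
    exact absurd h (by simp)

/-- The residues of the sequence at an index determined modulo `1320`. -/
theorem hardSeq_modEq_of_mod {Q n₀ : ℕ} {s r : ℕ × ℕ} {a b : ℤ}
    (h0 : (s.1 : ℤ) ≡ 2 * b [ZMOD Q]) (h1 : (s.2 : ℤ) ≡ a + b [ZMOD Q])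
    (hper : (fibStep Q)^[1320] s = s) (hr : (fibStep Q)^[n₀] s = r) {n : ℕ}
    (hn : n % 1320 = n₀) :
    (r.1 : ℤ) ≡ hardSeq a b n [ZMOD Q] ∧ (r.2 : ℤ) ≡ hardSeq a b (n + 1) [ZMOD Q] := by
  have hmod : (fibStep Q)^[n] s = (fibStep Q)^[n % 1320] s :=
    (Function.IsPeriodicPt.iterate_mod_apply (n := 1320) hper n).symm
  have A := hardSeq_modEq_iterate h0 h1 n
  rw [hmod, hn, hr] at A
  exact A

theorem hardSeq_invariant (a b : ℤ) (n : ℕ) :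
    hardSeq a b (n + 1) ^ 2 - hardSeq a b (n + 1) * hardSeq a b n - hardSeq a b n ^ 2 =
      (-1) ^ n * (a ^ 2 - 5 * b ^ 2) := by
  induction n with
  | zero => rw [hardSeq_zero, hardSeq_one]; ring
  | succ n ih =>
    rw [hardSeq_add_two, pow_succ]
    linear_combination -ih

theorem hardSeq_companion (a b : ℤ) (n : ℕ) :
    (2 * hardSeq a b (n + 1) - hardSeq a b n) ^ 2 =
      5 * hardSeq a b n ^ 2 + 4 * ((-1) ^ n * (a ^ 2 - 5 * b ^ 2)) := by
  linear_combination 4 * hardSeq_invariant a b n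

/-- Divisibility of `r + √D` by an element of norm `±m`. -/
def SplitsOff (D m r : ℤ) : Prop :=
  ∃ σ : ℤ√D, (σ.norm = m ∨ σ.norm = -m) ∧ σ ∣ (⟨r, 1⟩ : ℤ√D)

/-- The class number one property of the primitive forms of discriminant `4 * D`, restricted to
small leading coefficients. -/
def SmallSplit (D : ℤ) : Prop :=
  ∀ m n r : ℤ, m ≠ 0 → m ^ 2 ≤ D → 2 * |r| ≤ |m| → m * n = r ^ 2 - D →
    (∀ d : ℤ, d ∣ m → d ∣ 2 * r → d ∣ n → d ∣ 1) → SplitsOff D m r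

theorem exists_two_mul_abs_sub_le {m : ℤ} (r : ℤ) (hm : m ≠ 0) :
    ∃ k : ℤ, 2 * |r - k * m| ≤ |m| := by
  have hpos : 0 < |m| := abs_pos.2 hm
  have h1 := Int.emod_nonneg (r * 2 + |m|) (b := 2 * |m|) (by omega)
  have h2 := Int.emod_lt_of_pos (r * 2 + |m|) (b := 2 * |m|) (by omega)
  have h3 := Int.emod_add_mul_ediv (r * 2 + |m|) (2 * |m|)
  set q := (r * 2 + |m|) / (2 * |m|)
  have key : 2 * |r - q * (|m|)| ≤ |m| := by
    rw [← abs_two (α := ℤ), ← abs_mul, abs_le]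
    constructor <;> linarith
  rcases abs_choice m with h | h
  · exact ⟨q, by rw [h] at key; rwa [h]⟩
  · refine ⟨-q, ?_⟩
    rw [neg_mul, ← mul_neg, ← h]
    exact key

theorem splitsOff_of_smallSplit {D : ℤ} (hD : 0 < D) (hsq : ∀ r : ℤ, r ^ 2 ≠ D)
    (hsmall : SmallSplit D) :
    ∀ (N : ℕ) (m n r : ℤ), m.natAbs = N → m ≠ 0 → m * n = r ^ 2 - D →
      (∀ d : ℤ, d ∣ m → d ∣ 2 * r → d ∣ n → d ∣ 1) → SplitsOff D m r := by
  intro N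
  induction N using Nat.strong_induction_on with
  | _ N ih =>
  intro m n r hN hm hmn hprim
  obtain ⟨k, hk⟩ := exists_two_mul_abs_sub_le r hm
  set r' := r - k * m with hr'
  set n' := n - 2 * k * r + k ^ 2 * m with hn'
  have hmn' : m * n' = r' ^ 2 - D := by rw [hn', hr']; linear_combination hmn
  have hprim' : ∀ d : ℤ, d ∣ m → d ∣ 2 * r' → d ∣ n' → d ∣ 1 := by
    intro d hd1 hd2 hd3
    have hd4 : d ∣ 2 * r := by
      have := hd2.add (hd1.mul_left (2 * k))
      rwa [show 2 * r' + 2 * k * m = 2 * r by rw [hr']; ring] at this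
    refine hprim d hd1 hd4 ?_
    have := (hd3.add (hd4.mul_left k)).sub (hd1.mul_left (k ^ 2))
    rwa [show n' + k * (2 * r) - k ^ 2 * m = n by rw [hn']; ring] at this
  suffices h : SplitsOff D m r' by
    obtain ⟨σ, hσ, hdvd⟩ := h
    refine ⟨σ, hσ, ?_⟩
    have hm' : σ ∣ (m : ℤ√D) := by
      have h1 : σ ∣ (σ.norm : ℤ√D) := ⟨star σ, Zsqrtd.norm_eq_mul_conj σ⟩
      rcases hσ with h | h <;> rw [h] at h1
      · exact h1
      · rwa [Int.cast_neg, dvd_neg] at h1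
    have : (⟨r, 1⟩ : ℤ√D) = ⟨r', 1⟩ + (k : ℤ√D) * (m : ℤ√D) := by
      ext <;> simp [hr']
    rw [this]
    exact dvd_add hdvd (hm'.mul_left _)
  by_cases hmD : m ^ 2 ≤ D
  · exact hsmall m n' r' hm hmD hk hmn' hprim'
  push Not at hmD
  have hn0 : n' ≠ 0 := by
    intro h
    rw [h, mul_zero] at hmn'
    exact hsq r' (by linarith)
  have hlt : n'.natAbs < m.natAbs := by
    have hpos : 0 < |m| := abs_pos.2 hm
    have h4 : 4 * r' ^ 2 ≤ m ^ 2 := by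
      have := pow_le_pow_left₀ (by positivity) hk 2
      rw [mul_pow, sq_abs, sq_abs] at this
      linarith
    have h5 : |m| * |n'| < |m| * |m| := by
      rw [← abs_mul, hmn', ← abs_mul, ← sq, abs_of_nonneg (sq_nonneg m), abs_lt]
      constructor <;> nlinarith [sq_nonneg r', sq_nonneg m]
    have h6 := lt_of_mul_lt_mul_left h5 hpos.le
    rwa [Int.abs_eq_natAbs, Int.abs_eq_natAbs, Nat.cast_lt] at h6
  obtain ⟨σ', hσ', κ, hκ⟩ := ih n'.natAbs (hN ▸ hlt) n' m (-r') rfl hn0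
    (by linear_combination hmn')
    (fun d h1 h2 h3 ↦ hprim' d h3 (by rwa [mul_neg, dvd_neg] at h2) h1)
  refine ⟨star κ, ?_, -star σ', ?_⟩
  · have hnorm : n' * m = σ'.norm * κ.norm := by
      rw [← Zsqrtd.norm_mul, ← hκ, Zsqrtd.norm_def]
      linear_combination hmn'
    rw [Zsqrtd.norm_conj]
    rcases hσ' with h | h <;> rw [h] at hnorm
    · exact Or.inl (mul_left_cancel₀ hn0 hnorm.symm)
    · exact Or.inr (mul_left_cancel₀ hn0 (by rw [mul_neg, hnorm, neg_mul, neg_neg]))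
  · have := congrArg star hκ
    rw [star_mul] at this
    rw [mul_neg, ← this]
    ext <;> simp

/-- A computable certificate for `SmallSplit D` when `D < 400`: every relevant pair `(m, r)` is
split off by one of the listed elements. -/
def smallSplitCheck (D : ℤ) (W : List (ℤ × ℤ)) : Bool :=
  (List.range 40).all fun i ↦ (List.range 20).all fun j ↦
    let m : ℤ := i - 20
    let r : ℤ := j - 10
    m == 0 || !((r ^ 2 - D) % m == 0) ||
      !(Int.gcd (Int.gcd m (2 * r)) ((r ^ 2 - D) / m) == 1) || decide (D < m ^ 2) ||
      W.any fun p ↦ (p.1 ^ 2 - D * p.2 ^ 2 == m || p.1 ^ 2 - D * p.2 ^ 2 == -m) &&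
        (r * p.1 - D * p.2) % m == 0 && (p.1 - r * p.2) % m == 0

theorem smallSplit_of_check {D : ℤ} (hD : D < 400) {W : List (ℤ × ℤ)}
    (h : smallSplitCheck D W = true) : SmallSplit D := by
  intro m n r hm hmD hr hmn hprim
  have hm20 : |m| < 20 := by
    by_contra! hc
    have := sq_abs m
    nlinarith
  rw [abs_lt] at hm20
  have hr10 : |r| < 10 := by
    have : |m| < 20 := abs_lt.2 hm20
    omega
  rw [abs_lt] at hr10
  simp only [smallSplitCheck, List.all_eq_true, List.mem_range] at h
  have h' := h (m + 20).toNat (by omega) (r + 10).toNat (by omega)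
  rw [show (((m + 20).toNat : ℕ) : ℤ) - 20 = m by omega,
    show (((r + 10).toNat : ℕ) : ℤ) - 10 = r by omega] at h'
  have hdvd : (r ^ 2 - D) % m = 0 := Int.emod_eq_zero_of_dvd ⟨n, hmn.symm⟩
  have hdiv : (r ^ 2 - D) / m = n := by rw [← hmn, Int.mul_ediv_cancel_left _ hm]
  have hgcd : Int.gcd (Int.gcd m (2 * r)) n = 1 := by
    have h0 : ((Int.gcd (Int.gcd m (2 * r)) n : ℕ) : ℤ) ∣ ((Int.gcd m (2 * r) : ℕ) : ℤ) :=
      Int.gcd_dvd_left _ _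
    have := hprim _ (h0.trans (Int.gcd_dvd_left _ _)) (h0.trans (Int.gcd_dvd_right _ _))
      (Int.gcd_dvd_right _ _)
    exact Nat.dvd_one.1 (by exact_mod_cast this)
  simp only [hdvd, hdiv, hgcd, hm, hmD.not_gt, List.any_eq_true, Bool.or_eq_true,
    Bool.and_eq_true, beq_iff_eq, decide_eq_true_eq, Bool.not_eq_true', beq_self_eq_true,
    Bool.true_eq_false, false_or, or_false] at h'
  obtain ⟨⟨s, t⟩, -, ⟨hnorm, h1⟩, h2⟩ := h'
  obtain ⟨u, hu⟩ := Int.dvd_of_emod_eq_zero h1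
  obtain ⟨v, hv⟩ := Int.dvd_of_emod_eq_zero h2
  simp only at hnorm hu hv
  have hσ : (⟨s, t⟩ : ℤ√D).norm = m ∨ (⟨s, t⟩ : ℤ√D).norm = -m := by
    rw [Zsqrtd.norm_def]
    simpa only [sq, mul_assoc] using hnorm
  refine ⟨⟨s, t⟩, hσ, ?_⟩
  -- `m * (r + √D) = ± m * (s + t√D) * (u + v√D)`
  rcases hnorm with hnorm | hnorm
  · refine ⟨⟨u, v⟩, ?_⟩
    ext
    · simp only [Zsqrtd.re_mul]
      apply mul_left_cancel₀ hm
      linear_combination s * hu + D * t * hv - r * hnorm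
    · simp only [Zsqrtd.im_mul]
      apply mul_left_cancel₀ hm
      linear_combination t * hu + s * hv - hnorm
  · refine ⟨⟨-u, -v⟩, ?_⟩
    ext
    · simp only [Zsqrtd.re_mul]
      apply mul_left_cancel₀ hm
      linear_combination -s * hu - D * t * hv + r * hnorm
    · simp only [Zsqrtd.im_mul]
      apply mul_left_cancel₀ hm
      linear_combination -t * hu - s * hv + hnorm

/-- An element of norm `x ^ k` whose image under `√D ↦ -y` vanishes modulo `x`, while that of its
conjugate is a unit, is divisible by the `k`-th power of `σ`. -/
theorem pow_dvd_of_norm_eq_pow {D x y : ℤ} {σ P : ℤ√D} (hσ : σ.norm = x ∨ σ.norm = -x)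
    (hdvd : σ ∣ (⟨y, 1⟩ : ℤ√D)) (φ : ℤ√D →+* ZMod x.natAbs)
    (hφ : ∀ z : ℤ√D, φ z = z.re - z.im * y) (hx : x ≠ 0) (hstar : IsUnit (φ (star P)))
    {k : ℕ} (hP : P.norm = x ^ k) : σ ^ k ∣ P := by
  have hx0 : ((x : ℤ) : ZMod x.natAbs) = 0 := by
    rw [ZMod.intCast_zmod_eq_zero_iff_dvd, Int.natAbs_dvd]
  have hσx : σ ∣ (x : ℤ√D) := by
    have h1 : σ ∣ (σ.norm : ℤ√D) := ⟨star σ, Zsqrtd.norm_eq_mul_conj σ⟩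
    rcases hσ with h | h <;> rw [h] at h1
    · exact h1
    · rwa [Int.cast_neg, dvd_neg] at h1
  suffices h : ∀ j ≤ k, σ ^ j ∣ P from h k le_rfl
  intro j
  induction j with
  | zero => simp
  | succ j ih =>
    intro hj
    obtain ⟨κ, hκ⟩ := ih (by omega)
    suffices h : σ ∣ κ by
      rw [hκ, pow_succ]
      exact mul_dvd_mul_left _ h
    have hn : x ∣ κ.norm := by
      have h1 : σ.norm ^ j * κ.norm = x ^ k := by
        rw [← hP, hκ, Zsqrtd.norm_mul]
        congr 1
        exact (map_pow Zsqrtd.normMonoidHom σ j).symm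
      have h2 : x ^ j * κ.norm = x ^ k ∨ x ^ j * κ.norm = - x ^ k := by
        rcases hσ with h | h
        · left; rw [← h1, h]
        · rcases Nat.even_or_odd j with he | ho
          · left; rw [← h1, h, he.neg_pow]
          · right; rw [← h1, h, ho.neg_pow]; ring
      obtain ⟨i, rfl⟩ : ∃ i, k = j + 1 + i := ⟨k - (j + 1), by omega⟩
      have hxj : x ^ j ≠ 0 := pow_ne_zero _ hx
      rcases h2 with h2 | h2
      · exact ⟨x ^ i, mul_left_cancel₀ hxj (by rw [h2]; ring)⟩
      · exact ⟨-x ^ i, mul_left_cancel₀ hxj (by rw [h2]; ring)⟩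
    have hφκ : φ κ = 0 := by
      have h1 : φ κ * φ (star κ) = 0 := by
        rw [← map_mul, ← Zsqrtd.norm_eq_mul_conj, map_intCast]
        obtain ⟨c, hc⟩ := hn
        rw [hc, Int.cast_mul, hx0, zero_mul]
      have h2 : IsUnit (φ (star κ)) := by
        rw [hκ, star_mul, map_mul] at hstar
        exact isUnit_of_mul_isUnit_left hstar
      rwa [h2.mul_left_eq_zero] at h1
    have hxκ : x ∣ κ.re - κ.im * y := by
      rw [hφ] at hφκ
      rw [← Int.natAbs_dvd, ← ZMod.intCast_zmod_eq_zero_iff_dvd]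
      push_cast
      exact hφκ
    obtain ⟨c, hc⟩ := hxκ
    have : κ = κ.im * (⟨y, 1⟩ : ℤ√D) + (x : ℤ√D) * c := by
      ext
      · simp; linarith
      · simp
    rw [this]
    exact dvd_add (hdvd.mul_left _) (hσx.mul_right _)

theorem exists_norm_one_cofactor {D x y y₀ : ℤ} (hDy : D = y₀ ^ 2 - 5) (hD : 0 < D)
    (hsq : ∀ r : ℤ, r ^ 2 ≠ D) (hsmall : SmallSplit D) (hx : x ≠ 0) (hcop : IsCoprime x (2 * y))
    (h5 : y ≡ y₀ [ZMOD 5]) (h : y ^ 2 = 5 * x ^ 22 + D) :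
    ∃ σ η : ℤ√D, η.norm = 1 ∧ (⟨y, 1⟩ : ℤ√D) = ⟨y₀, 1⟩ * (σ ^ 22 * η) := by
  obtain ⟨k, hk⟩ := h5.symm.dvd
  obtain rfl : y = y₀ + 5 * k := by linarith
  obtain ⟨σ, hσ, hdvd⟩ := splitsOff_of_smallSplit hD hsq hsmall x.natAbs x (5 * x ^ 21)
    (y₀ + 5 * k) rfl hx (by linear_combination -h) (by
      intro d h1 h2 _
      obtain ⟨u, v, huv⟩ := hcop
      rw [← huv]
      exact dvd_add (h1.mul_left u) (h2.mul_left v))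
  set P : ℤ√D := ⟨k * y₀ + 1, -k⟩ with hP
  have hAP : (⟨y₀ + 5 * k, 1⟩ : ℤ√D) = ⟨y₀, 1⟩ * P := by
    ext
    · simp only [hP, Zsqrtd.re_mul]
      linear_combination k * hDy
    · simp only [hP, Zsqrtd.im_mul]
      ring
  have hPnorm : P.norm = x ^ 22 := by
    rw [hP, Zsqrtd.norm_def]
    linarith [show 5 * ((k * y₀ + 1) * (k * y₀ + 1) - D * -k * -k) = 5 * x ^ 22 by
      linear_combination h + (1 - 5 * k ^ 2) * hDy]
  have hroot : (-((y₀ + 5 * k : ℤ) : ZMod x.natAbs)) * (-((y₀ + 5 * k : ℤ) : ZMod x.natAbs)) =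
      (D : ZMod x.natAbs) := by
    have hx0 : ((x : ℤ) : ZMod x.natAbs) = 0 := by
      rw [ZMod.intCast_zmod_eq_zero_iff_dvd, Int.natAbs_dvd]
    have := congrArg (Int.cast : ℤ → ZMod x.natAbs) h
    simp only [Int.cast_add, Int.cast_mul, Int.cast_pow, hx0] at this ⊢
    linear_combination this
  have hφ : ∀ z : ℤ√D, Zsqrtd.lift ⟨_, hroot⟩ z =
      (z.re : ZMod x.natAbs) - z.im * ((y₀ + 5 * k : ℤ) : ZMod x.natAbs) := by
    intro z
    simp only [Zsqrtd.lift_apply_apply]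
    ring
  have hunit : IsUnit (Zsqrtd.lift ⟨_, hroot⟩ (star P)) := by
    have h1 : IsUnit (Zsqrtd.lift ⟨_, hroot⟩ (star (⟨y₀ + 5 * k, 1⟩ : ℤ√D))) := by
      rw [hφ]
      have h2 : IsUnit ((2 * (y₀ + 5 * k) : ℤ) : ZMod x.natAbs) := by
        obtain ⟨u, v, huv⟩ := hcop
        have hx0 : ((x : ℤ) : ZMod x.natAbs) = 0 := by
          rw [ZMod.intCast_zmod_eq_zero_iff_dvd, Int.natAbs_dvd]
        refine IsUnit.of_mul_eq_one (v : ZMod x.natAbs) ?_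
        have := congrArg (Int.cast : ℤ → ZMod x.natAbs) huv
        rw [Int.cast_add, Int.cast_mul u, hx0, mul_zero, zero_add, Int.cast_mul, mul_comm] at this
        rw [this, Int.cast_one]
      convert h2 using 1
      simp only [Zsqrtd.re_star, Zsqrtd.im_star]
      push_cast
      ring
    rw [hAP, star_mul, map_mul] at h1
    exact isUnit_of_mul_isUnit_left h1
  obtain ⟨η, hη⟩ := pow_dvd_of_norm_eq_pow hσ hdvd _ hφ hx hunit hPnorm
  refine ⟨σ, η, ?_, by rw [hAP, hη]⟩
  have h1 : (σ ^ 22).norm * η.norm = x ^ 22 := by rw [← hPnorm, hη, Zsqrtd.norm_mul]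
  have h2 : (σ ^ 22).norm = x ^ 22 := by
    have : (σ ^ 22).norm = σ.norm ^ 22 := map_pow Zsqrtd.normMonoidHom σ 22
    rw [this]
    rcases hσ with h | h <;> rw [h]
    exact Even.neg_pow (by decide) x
  rw [h2] at h1
  exact mul_left_cancel₀ (pow_ne_zero 22 hx) (by rw [h1, mul_one])

/-- A norm-one element whose image in `𝔽_q` is a `((q - 1) / 11)`-th root of unity is an eleventh
power, as soon as one norm-one element is an eleventh power non-residue modulo `q`. -/
theorem exists_eq_pow_of_residue {D : ℤ} (hD : 0 < D) (hsq : ¬IsSquare D) {q k : ℕ}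
    [Fact q.Prime] (hq : q = 11 * k + 1) (hk : Even k) (ψ : ℤ√D →+* ZMod q)
    (e : Pell.Solution₁ D) (he : ψ (e : ℤ√D) ^ k ≠ 1) (η : Pell.Solution₁ D)
    (hη : ψ (η : ℤ√D) ^ k = 1) : ∃ ξ : Pell.Solution₁ D, η = ξ ^ 11 := by
  obtain ⟨ε, hε⟩ := Pell.IsFundamental.exists_of_not_isSquare hD hsq
  let χ : Pell.Solution₁ D →* (ZMod q)ˣ :=
    (powMonoidHom k).comp ((Units.map (ψ : ℤ√D →* ZMod q)).comp Unitary.toUnits)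
  have hχ : ∀ a : Pell.Solution₁ D, ((χ a : (ZMod q)ˣ) : ZMod q) = ψ (a : ℤ√D) ^ k :=
    fun a ↦ rfl
  have hχneg : ∀ a : Pell.Solution₁ D, χ (-a) = χ a := by
    intro a
    ext
    rw [hχ, hχ, show ((-a : Pell.Solution₁ D) : ℤ√D) = -(a : ℤ√D) from rfl, map_neg, hk.neg_pow]
  have hχ11 : ∀ a, χ a ^ 11 = 1 := by
    intro a
    have := ZMod.units_pow_card_sub_one_eq_one q
      (Units.map (ψ : ℤ√D →* ZMod q) (Unitary.toUnits a))
    rwa [show q - 1 = k * 11 by omega, pow_mul] at this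
  have hne : χ ε ≠ 1 := by
    intro h1
    apply he
    rw [← hχ, Units.val_eq_one]
    obtain ⟨n, hn | hn⟩ := hε.eq_zpow_or_neg_zpow e
    · rw [hn, map_zpow, h1, one_zpow]
    · rw [hn, hχneg, map_zpow, h1, one_zpow]
  have : Fact (Nat.Prime 11) := ⟨by norm_num⟩
  have hord : orderOf (χ ε) = 11 := orderOf_eq_prime (hχ11 ε) hne
  have key : ∀ n : ℤ, χ ε ^ n = 1 → ∃ m : ℤ, n = m * 11 := by
    intro n hn
    obtain ⟨m, hm⟩ := orderOf_dvd_iff_zpow_eq_one.2 hn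
    rw [hord] at hm
    exact ⟨m, by rw [hm]; push_cast; ring⟩
  have hη1 : χ η = 1 := by
    ext
    rw [hχ, hη, Units.val_one]
  obtain ⟨n, hn | hn⟩ := hε.eq_zpow_or_neg_zpow η
  · obtain ⟨m, rfl⟩ := key n (by rw [← map_zpow, ← hn, hη1])
    exact ⟨ε ^ m, by rw [hn, zpow_mul]; norm_cast⟩
  · obtain ⟨m, rfl⟩ := key n (by rw [← map_zpow, ← hχneg, ← hn, hη1])
    refine ⟨-ε ^ m, ?_⟩
    rw [hn, Odd.neg_pow (by decide), zpow_mul]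
    norm_cast

theorem re_im_mod_three {D s t : ℤ} (hD : (D : ZMod 3) ≠ 0)
    (hre : (((⟨s, t⟩ : ℤ√D) ^ 11).re : ZMod 3) = 1)
    (him : (((⟨s, t⟩ : ℤ√D) ^ 11).im : ZMod 3) = 0) :
    (s : ZMod 3) = 1 ∧ (t : ZMod 3) = 0 := by
  have h2 : ∀ a b : ℤ, (⟨a, b⟩ : ℤ√D) * ⟨a, b⟩ = ⟨a * a + D * b * b, 2 * a * b⟩ := by
    intro a b
    ext <;> simp only [Zsqrtd.re_mul, Zsqrtd.im_mul]
    ring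
  rw [show ∀ z : ℤ√D, z ^ 11 = (z * z) * (z * z) * ((z * z) * (z * z)) * (z * z * z) from
    fun z ↦ by ring, h2, h2, h2] at hre him
  simp only [Zsqrtd.re_mul, Zsqrtd.im_mul] at hre him
  push_cast at hre him
  generalize (D : ZMod 3) = d at *
  generalize (s : ZMod 3) = a at *
  generalize (t : ZMod 3) = b at *
  revert a b d
  decide +kernel

/-- Solutions of `y ^ 2 = 5 * x ^ 22 + D` congruent to the trivial one come from eleventh powers
in `ℤ[√D]`. -/
theorem exists_eq_mul_pow_eleven {D x y y₀ : ℤ} (hDy : D = y₀ ^ 2 - 5) (hD : 0 < D)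
    (hsq : ∀ r : ℤ, r ^ 2 ≠ D) (hsmall : SmallSplit D) (hx : x ≠ 0) (hcop : IsCoprime x (2 * y))
    (h5 : y ≡ y₀ [ZMOD 5]) (h3 : y ≡ y₀ [ZMOD 3]) (hD3 : (D : ZMod 3) ≠ 0) {q k : ℕ}
    [Fact q.Prime] (hq : q = 11 * k + 1) (hk : Even k) (hyq : y ≡ y₀ [ZMOD q]) {c : ℤ}
    (hc : (c : ZMod q) * c = D) (hcy : (y₀ + c : ZMod q) ≠ 0) (e : Pell.Solution₁ D)
    (he : (e.x + e.y * c : ZMod q) ^ k ≠ 1) (h : y ^ 2 = 5 * x ^ 22 + D) :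
    ∃ s t : ℤ, (⟨y, 1⟩ : ℤ√D) = ⟨y₀, 1⟩ * ⟨s, t⟩ ^ 11 ∧ 3 ∣ s - 1 ∧ 3 ∣ t := by
  obtain ⟨σ, η, hη, hP⟩ := exists_norm_one_cofactor hDy hD hsq hsmall hx hcop h5 h
  have hψ : ∀ z : ℤ√D, Zsqrtd.lift ⟨_, hc⟩ z = (z.re + z.im * c : ZMod q) := fun z ↦ by
    simp only [Zsqrtd.lift_apply_apply]
  have hres : Zsqrtd.lift ⟨_, hc⟩ η ^ k = 1 := by
    have h1 := congrArg (Zsqrtd.lift ⟨_, hc⟩) hP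
    rw [map_mul, hψ, hψ] at h1
    simp only [(ZMod.intCast_eq_intCast_iff _ _ q).2 hyq, Int.cast_one, one_mul] at h1
    have h2 := mul_left_cancel₀ hcy ((mul_one _).trans h1)
    have hσ0 : Zsqrtd.lift ⟨_, hc⟩ σ ≠ 0 := by
      intro h0
      rw [map_mul, map_pow, h0] at h2
      simp at h2
    have h3 := congrArg (· ^ k) h2
    simp only [one_pow] at h3
    rw [map_mul, map_pow, mul_pow, ← pow_mul, show 22 * k = (q - 1) * 2 by omega, pow_mul,
      ZMod.pow_card_sub_one_eq_one hσ0, one_pow, one_mul] at h3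
    exact h3.symm
  have hns : ¬IsSquare D := by
    rintro ⟨r, hr⟩
    exact hsq r (by rw [hr, sq])
  have hηm : η ∈ unitary (ℤ√D) := Zsqrtd.norm_eq_one_iff_mem_unitary.1 hη
  obtain ⟨ξ, hξ⟩ := exists_eq_pow_of_residue hD hns hq hk (Zsqrtd.lift ⟨_, hc⟩) e
    (by rw [hψ]; exact he) ⟨η, hηm⟩ hres
  have hξ' : η = (ξ : ℤ√D) ^ 11 := by
    have := congrArg (Subtype.val) hξ
    exact this
  obtain ⟨τ, hτ⟩ : ∃ τ : ℤ√D, τ = σ ^ 2 * ξ := ⟨_, rfl⟩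
  have hPτ : (⟨y, 1⟩ : ℤ√D) = ⟨y₀, 1⟩ * τ ^ 11 := by
    rw [hP, hξ', hτ]
    ring
  obtain ⟨s, t⟩ := τ
  refine ⟨s, t, hPτ, ?_⟩
  have hre := congrArg Zsqrtd.re hPτ
  have him := congrArg Zsqrtd.im hPτ
  simp only [Zsqrtd.re_mul, Zsqrtd.im_mul] at hre him
  generalize hu : ((⟨s, t⟩ : ℤ√D) ^ 11).re = u at hre him
  generalize hv : ((⟨s, t⟩ : ℤ√D) ^ 11).im = v at hre him
  have hy3 : (y : ZMod 3) = y₀ := (ZMod.intCast_eq_intCast_iff _ _ 3).2 h3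
  have hv3 : 5 * v = y₀ - y := by linear_combination hre - y₀ * him + v * hDy
  have hu3 : 5 * u = y * y₀ - D := by linear_combination -y₀ * hre + D * him + u * hDy
  have h5u : (2 : ZMod 3) * u = 2 := by
    have := congrArg (Int.cast : ℤ → ZMod 3) hu3
    rw [hDy] at this
    push_cast at this
    rw [hy3] at this
    linear_combination this - (u - 1) * (by decide : (3 : ZMod 3) = 0)
  have h5v : (2 : ZMod 3) * v = 0 := by
    have := congrArg (Int.cast : ℤ → ZMod 3) hv3
    push_cast at this
    rw [hy3] at this
    linear_combination this - v * (by decide : (3 : ZMod 3) = 0)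
  have hu1 : (u : ZMod 3) = 1 := by
    generalize (u : ZMod 3) = w at *
    revert w; decide
  have hv1 : (v : ZMod 3) = 0 := by
    generalize (v : ZMod 3) = w at *
    revert w; decide
  obtain ⟨hs, ht⟩ := re_im_mod_three hD3 (by rw [hu, hu1]) (by rw [hv, hv1])
  constructor
  · have := (ZMod.intCast_zmod_eq_zero_iff_dvd (s - 1) 3).1 (by push_cast; rw [hs, sub_self])
    exact this
  · exact (ZMod.intCast_zmod_eq_zero_iff_dvd t 3).1 ht

/-- The spanning family `1`, `a ^ (6 + j) b ^ (5 - j) + a ^ (5 - j) b ^ (6 + j)` for `0 ≤ j ≤ 4`,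
`a ^ (11 + i) b ^ (11 - i) + a ^ (11 - i) b ^ (11 + i)` for `1 ≤ i ≤ 5`, of a ring of symmetric
expressions in `a` and `b`. -/
def symBasis {R : Type*} [CommRing R] (a b : R) : Fin 11 → R :=
  ![1, a ^ 6 * b ^ 5 + a ^ 5 * b ^ 6, a ^ 7 * b ^ 4 + a ^ 4 * b ^ 7, a ^ 8 * b ^ 3 + a ^ 3 * b ^ 8,
    a ^ 9 * b ^ 2 + a ^ 2 * b ^ 9, a ^ 10 * b + a * b ^ 10,
    a ^ 12 * b ^ 10 + a ^ 10 * b ^ 12, a ^ 13 * b ^ 9 + a ^ 9 * b ^ 13,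
    a ^ 14 * b ^ 8 + a ^ 8 * b ^ 14, a ^ 15 * b ^ 7 + a ^ 7 * b ^ 15,
    a ^ 16 * b ^ 6 + a ^ 6 * b ^ 16]

/-- The element with given integral coordinates with respect to `symBasis a b`. -/
def symEval {R : Type*} [CommRing R] (a b : R) (x : Fin 11 → ℤ) : R :=
  ∑ i, x i * symBasis a b i

theorem symEval_eq {R : Type*} [CommRing R] (a b : R) (x : Fin 11 → ℤ) :
    symEval a b x = x 0 + x 1 * (a ^ 6 * b ^ 5 + a ^ 5 * b ^ 6)
      + x 2 * (a ^ 7 * b ^ 4 + a ^ 4 * b ^ 7) + x 3 * (a ^ 8 * b ^ 3 + a ^ 3 * b ^ 8)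
      + x 4 * (a ^ 9 * b ^ 2 + a ^ 2 * b ^ 9) + x 5 * (a ^ 10 * b + a * b ^ 10)
      + x 6 * (a ^ 12 * b ^ 10 + a ^ 10 * b ^ 12) + x 7 * (a ^ 13 * b ^ 9 + a ^ 9 * b ^ 13)
      + x 8 * (a ^ 14 * b ^ 8 + a ^ 8 * b ^ 14) + x 9 * (a ^ 15 * b ^ 7 + a ^ 7 * b ^ 15)
      + x 10 * (a ^ 16 * b ^ 6 + a ^ 6 * b ^ 16) := by
  simp only [symEval, Fin.sum_univ_succ, symBasis, Fin.sum_univ_zero]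
  simp
  ring

/-- Multiplication in coordinates with respect to `symBasis a b`, where `P = a ^ 11 + b ^ 11` and
`q = a ^ 11 * b ^ 11`. -/
def symMul (P q : ℤ) (x y : Fin 11 → ℤ) : Fin 11 → ℤ :=
  ![
    (x 0 * y 0) + 2 * q * (x 1 * y 1 + x 2 * y 2 + x 3 * y 3 + x 4 * y 4 + x 5 * y 5) + 2 * q
      ^ 2 * (x 6 * y 6 + x 7 * y 7 + x 8 * y 8 + x 9 * y 9 + x 10 * y 10) + P * q * (x 1 * y
      10 + x 2 * y 9 + x 3 * y 8 + x 4 * y 7 + x 5 * y 6 + x 6 * y 5 + x 7 * y 4 + x 8 * y 3 +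
      x 9 * y 2 + x 10 * y 1),
    (x 0 * y 1 + x 1 * y 0) + q * (x 1 * y 6 + x 2 * y 6 + x 2 * y 7 + x 3 * y 7 + x 3 * y 8 +
      x 4 * y 8 + x 4 * y 9 + x 5 * y 9 + x 5 * y 10 + x 6 * y 1 + x 6 * y 2 + x 7 * y 2 + x 7
      * y 3 + x 8 * y 3 + x 8 * y 4 + x 9 * y 4 + x 9 * y 5 + x 10 * y 5) + P * (x 2 * y 5 + x
      3 * y 4 + x 4 * y 3 + x 5 * y 2) + P * q * (x 6 * y 10 + x 7 * y 9 + x 8 * y 8 + x 9 * y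
      7 + x 10 * y 6),
    (x 0 * y 2 + x 2 * y 0) - q * (x 5 * y 10 + x 10 * y 5) + q * (x 1 * y 6 + x 1 * y 7 + x 2
      * y 8 + x 3 * y 6 + x 3 * y 9 + x 4 * y 7 + x 4 * y 10 + x 5 * y 8 + x 6 * y 1 + x 6 * y
      3 + x 7 * y 1 + x 7 * y 4 + x 8 * y 2 + x 8 * y 5 + x 9 * y 3 + x 10 * y 4) + P * (x 3 *
      y 5 + x 4 * y 4 + x 5 * y 3) + P * q * (x 7 * y 10 + x 8 * y 9 + x 9 * y 8 + x 10 * y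
      7),
    (x 0 * y 3 + x 3 * y 0) - q * (x 4 * y 10 + x 5 * y 9 + x 9 * y 5 + x 10 * y 4) + q * (x 1
      * y 7 + x 1 * y 8 + x 2 * y 6 + x 2 * y 9 + x 3 * y 10 + x 4 * y 6 + x 5 * y 7 + x 6 * y
      2 + x 6 * y 4 + x 7 * y 1 + x 7 * y 5 + x 8 * y 1 + x 9 * y 2 + x 10 * y 3) + P * (x 4 *
      y 5 + x 5 * y 4) + P * q * (x 8 * y 10 + x 9 * y 9 + x 10 * y 8),
    (x 0 * y 4 + x 4 * y 0) - q * (x 3 * y 10 + x 4 * y 9 + x 5 * y 8 + x 8 * y 5 + x 9 * y 4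
      + x 10 * y 3) + q * (x 1 * y 8 + x 1 * y 9 + x 2 * y 7 + x 2 * y 10 + x 3 * y 6 + x 5 *
      y 6 + x 6 * y 3 + x 6 * y 5 + x 7 * y 2 + x 8 * y 1 + x 9 * y 1 + x 10 * y 2) + P * (x 5
      * y 5) + P * q * (x 9 * y 10 + x 10 * y 9),
    (x 0 * y 5 + x 5 * y 0) - q * (x 2 * y 10 + x 3 * y 9 + x 4 * y 8 + x 5 * y 7 + x 7 * y 5
      + x 8 * y 4 + x 9 * y 3 + x 10 * y 2) + q * (x 1 * y 9 + x 1 * y 10 + x 2 * y 8 + x 3 *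
      y 7 + x 4 * y 6 + x 6 * y 4 + x 7 * y 3 + x 8 * y 2 + x 9 * y 1 + x 10 * y 1) + P * q *
      (x 10 * y 10),
    (x 0 * y 6 + x 1 * y 1 + x 1 * y 2 + x 2 * y 1 + x 2 * y 3 + x 3 * y 2 + x 3 * y 4 + x 4 *
      y 3 + x 4 * y 5 + x 5 * y 4 + x 6 * y 0) - q * (x 10 * y 10) + q * (x 6 * y 7 + x 7 * y
      6 + x 7 * y 8 + x 8 * y 7 + x 8 * y 9 + x 9 * y 8 + x 9 * y 10 + x 10 * y 9) + P * (x 2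
      * y 10 + x 3 * y 9 + x 4 * y 8 + x 5 * y 7 + x 7 * y 5 + x 8 * y 4 + x 9 * y 3 + x 10 *
      y 2),
    -(x 5 * y 5) + (x 0 * y 7 + x 1 * y 2 + x 1 * y 3 + x 2 * y 1 + x 2 * y 4 + x 3 * y 1 + x
      3 * y 5 + x 4 * y 2 + x 5 * y 3 + x 7 * y 0) - q * (x 9 * y 10 + x 10 * y 9) + q * (x 6
      * y 6 + x 6 * y 8 + x 7 * y 9 + x 8 * y 6 + x 8 * y 10 + x 9 * y 7 + x 10 * y 8) + P *
      (x 3 * y 10 + x 4 * y 9 + x 5 * y 8 + x 8 * y 5 + x 9 * y 4 + x 10 * y 3),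
    -(x 4 * y 5 + x 5 * y 4) + (x 0 * y 8 + x 1 * y 3 + x 1 * y 4 + x 2 * y 2 + x 2 * y 5 + x
      3 * y 1 + x 4 * y 1 + x 5 * y 2 + x 8 * y 0) - q * (x 8 * y 10 + x 9 * y 9 + x 10 * y 8)
      + q * (x 6 * y 7 + x 6 * y 9 + x 7 * y 6 + x 7 * y 10 + x 9 * y 6 + x 10 * y 7) + P * (x
      4 * y 10 + x 5 * y 9 + x 9 * y 5 + x 10 * y 4),
    -(x 3 * y 5 + x 4 * y 4 + x 5 * y 3) + (x 0 * y 9 + x 1 * y 4 + x 1 * y 5 + x 2 * y 3 + x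
      3 * y 2 + x 4 * y 1 + x 5 * y 1 + x 9 * y 0) - q * (x 7 * y 10 + x 8 * y 9 + x 9 * y 8 +
      x 10 * y 7) + q * (x 6 * y 8 + x 6 * y 10 + x 7 * y 7 + x 8 * y 6 + x 10 * y 6) + P * (x
      5 * y 10 + x 10 * y 5),
    -(x 2 * y 5 + x 3 * y 4 + x 4 * y 3 + x 5 * y 2) + (x 0 * y 10 + x 1 * y 5 + x 2 * y 4 + x
      3 * y 3 + x 4 * y 2 + x 5 * y 1 + x 10 * y 0) - q * (x 6 * y 10 + x 7 * y 9 + x 8 * y 8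
      + x 9 * y 7 + x 10 * y 6) + q * (x 6 * y 9 + x 7 * y 8 + x 8 * y 7 + x 9 * y 6)]

theorem symEval_mul {R : Type*} [CommRing R] {a b : R} {P q : ℤ} (hP : (P : R) = a ^ 11 + b ^ 11)
    (hq : (q : R) = a ^ 11 * b ^ 11) (x y : Fin 11 → ℤ) :
    symEval a b (symMul P q x y) = symEval a b x * symEval a b y := by
  rw [symEval_eq, symEval_eq, symEval_eq]
  simp [symMul]
  simp only [hP, hq]
  ring

/-- The Lucas sequence `U₀ = 0`, `U₁ = 1`, `U_{n+2} = P U_{n+1} - q U_n`. -/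
def lucasU {R : Type*} [CommRing R] (P q : R) : ℕ → R
  | 0 => 0
  | 1 => 1
  | n + 2 => P * lucasU P q (n + 1) - q * lucasU P q n

/-- The binary form of degree eleven attached to a pair of conjugates with sum `P` and
product `q`. -/
def thueForm {R : Type*} [CommRing R] (P q S t : R) : R :=
  S ^ 11 - q * ∑ k ∈ Finset.range 11,
    (-1) ^ (k + 1) * (Nat.choose 11 (k + 1) : R) * lucasU P q k * S ^ (10 - k) * t ^ (k + 1)

theorem map_lucasU {R R' : Type*} [CommRing R] [CommRing R'] (f : R →+* R') (P q : R) (n : ℕ) :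
    f (lucasU P q n) = lucasU (f P) (f q) n := by
  induction n using Nat.twoStepInduction with
  | zero => simp [lucasU]
  | one => simp [lucasU]
  | more n h1 h2 => simp [lucasU, h1, h2]

theorem map_thueForm {R R' : Type*} [CommRing R] [CommRing R'] (f : R →+* R') (P q S t : R) :
    f (thueForm P q S t) = thueForm (f P) (f q) (f S) (f t) := by
  simp [thueForm, map_lucasU]

theorem sub_mul_thueForm {R : Type*} [CommRing R] (A B S t : R) :
    (A - B) * thueForm (A + B) (A * B) S t = A * (S - t * B) ^ 11 - B * (S - t * A) ^ 11 := by
  simp only [thueForm, Finset.sum_range_succ, Finset.sum_range_zero, lucasU]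
  norm_num [Nat.choose]
  ring

theorem sub_mul_dvd_thueForm {R : Type*} [CommRing R] {P q S t ν : R}
    (h : thueForm P q ν 1 = 0) : S - t * ν ∣ thueForm P q S t := by
  have h1 : thueForm P q S t = thueForm P q S t - t ^ 11 * thueForm P q ν 1 := by
    rw [h, mul_zero, sub_zero]
  have hpow : ∀ n, S - t * ν ∣ S ^ n - (t * ν) ^ n := fun n ↦ sub_dvd_pow_sub_pow _ _ n
  have h2 : thueForm P q S t - t ^ 11 * thueForm P q ν 1 = (S ^ 11 - (t * ν) ^ 11) -
      q * ∑ k ∈ Finset.range 11, (-1) ^ (k + 1) * (Nat.choose 11 (k + 1) : R) * lucasU P q k *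
        t ^ (k + 1) * (S ^ (10 - k) - (t * ν) ^ (10 - k)) := by
    simp only [thueForm, mul_sub, Finset.sum_sub_distrib, one_pow, mul_one]
    have : t ^ 11 * (q * ∑ k ∈ Finset.range 11, (-1) ^ (k + 1) * (Nat.choose 11 (k + 1) : R) *
        lucasU P q k * ν ^ (10 - k)) = q * ∑ k ∈ Finset.range 11, (-1) ^ (k + 1) *
          (Nat.choose 11 (k + 1) : R) * lucasU P q k * t ^ (k + 1) * (t * ν) ^ (10 - k) := by
      rw [mul_left_comm, Finset.mul_sum]
      congr 1
      refine Finset.sum_congr rfl fun k hk ↦ ?_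
      have hk' := Finset.mem_range.1 hk
      rw [mul_pow, show (11 : ℕ) = (k + 1) + (10 - k) by omega, pow_add t,
        show k + 1 + (10 - k) = 11 by omega]
      ring
    rw [this, mul_pow]
    have h3 : ∀ k, (-1 : R) ^ (k + 1) * (Nat.choose 11 (k + 1) : R) * lucasU P q k *
        S ^ (10 - k) * t ^ (k + 1) = (-1) ^ (k + 1) * (Nat.choose 11 (k + 1) : R) *
          lucasU P q k * t ^ (k + 1) * S ^ (10 - k) := fun k ↦ by ring
    simp only [h3]
    ring
  rw [h1, h2]
  refine dvd_sub (hpow 11) (Dvd.dvd.mul_left (Finset.dvd_sum fun k _ ↦ ?_) q)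
  exact (hpow _).mul_left _

open Polynomial in
/-- The dehomogenised form as a polynomial. -/
noncomputable def thuePoly (P q : ℤ) : ℤ[X] := thueForm (C P) (C q) X 1

open Polynomial in
theorem thuePoly_eq (P q : ℤ) : thuePoly P q = X ^ 11 - C q * ∑ k ∈ Finset.range 11,
    C ((-1) ^ (k + 1) * (Nat.choose 11 (k + 1) : ℤ) * lucasU P q k) * X ^ (10 - k) := by
  simp only [thuePoly, thueForm, map_mul, map_lucasU (C : ℤ →+* ℤ[X]), map_pow, map_neg, map_one,
    map_natCast, one_pow, mul_one]

open Polynomial in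
theorem thuePoly_degree_aux (P q : ℤ) : (C q * ∑ k ∈ Finset.range 11,
    C ((-1) ^ (k + 1) * (Nat.choose 11 (k + 1) : ℤ) * lucasU P q k) * X ^ (10 - k) :
      ℤ[X]).degree < (11 : ℕ) := by
  rw [← smul_eq_C_mul]
  refine (degree_smul_le _ _).trans_lt ?_
  refine (degree_sum_le _ _).trans_lt ((Finset.sup_lt_iff (WithBot.bot_lt_coe _)).2 fun k _ ↦ ?_)
  refine (degree_C_mul_X_pow_le _ _).trans_lt ?_
  exact_mod_cast (by omega : 10 - k < 11)

open Polynomial in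
theorem thuePoly_monic (P q : ℤ) : (thuePoly P q).Monic := by
  rw [thuePoly_eq]
  exact monic_X_pow_sub (thuePoly_degree_aux P q)

open Polynomial in
theorem thuePoly_natDegree (P q : ℤ) : (thuePoly P q).natDegree = 11 := by
  rw [thuePoly_eq]
  apply natDegree_eq_of_degree_eq_some
  rw [degree_sub_eq_left_of_degree_lt, degree_X_pow]
  rw [degree_X_pow]
  exact thuePoly_degree_aux P q

open Polynomial in
theorem thuePoly_irreducible {P : ℤ} (hP : ¬ (5 : ℤ) ∣ P) : Irreducible (thuePoly P 5) := by
  have h5 : Prime (5 : ℤ) := Int.prime_iff_natAbs_prime.2 (by norm_num)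
  have hdeg := thuePoly_natDegree P 5
  have hmon := thuePoly_monic P 5
  have hprime : (Ideal.span {(5 : ℤ)}).IsPrime := (Ideal.span_singleton_prime h5.ne_zero).2 h5
  have heis : (thuePoly P 5).IsEisensteinAt (Ideal.span {(5 : ℤ)}) := by
    refine ⟨?_, ?_, ?_⟩
    · rw [hmon.leadingCoeff, Ideal.mem_span_singleton]
      decide
    · intro n hn
      rw [hdeg] at hn
      rw [Ideal.mem_span_singleton, thuePoly_eq, coeff_sub, coeff_X_pow, if_neg hn.ne, coeff_C_mul,
        zero_sub, dvd_neg]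
      exact dvd_mul_right _ _
    · have h0 : (thuePoly P 5).coeff 0 = 5 * lucasU P 5 10 := by
        rw [thuePoly_eq, coeff_zero_eq_eval_zero]
        simp [Finset.sum_range_succ]
      rw [h0, Ideal.span_singleton_pow, Ideal.mem_span_singleton, sq,
        mul_dvd_mul_iff_left (by norm_num : (5 : ℤ) ≠ 0)]
      intro h
      have h10 : lucasU P 5 10 =
          P ^ 9 + 5 * (-8 * P ^ 7 + 105 * P ^ 5 - 500 * P ^ 3 + 625 * P) := by
        simp only [lucasU]
        ring
      rw [h10, Int.dvd_add_left (dvd_mul_right _ _)] at h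
      exact hP (h5.dvd_of_dvd_pow h)
  exact heis.irreducible hprime hmon.isPrimitive (by rw [hdeg]; norm_num)

/-- Coordinates of `∑ aⁱ b ^ (11 - i)`, `1 ≤ i ≤ 10`, with respect to `symBasis a b`. -/
def symTrace : Fin 11 → ℤ := ![0, 1, 1, 1, 1, 1, 0, 0, 0, 0, 0]

theorem thueForm_neg_symTrace {a b : ℝ} {P q : ℤ} (hP : (P : ℝ) = a ^ 11 + b ^ 11)
    (hq : (q : ℝ) = a ^ 11 * b ^ 11) (hab : a ^ 11 ≠ b ^ 11) :
    thueForm (P : ℝ) q (-symEval a b symTrace) 1 = 0 := by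
  have h := sub_mul_thueForm (a ^ 11) (b ^ 11) (-symEval a b symTrace) 1
  rw [← hP, ← hq] at h
  have h0 : a ^ 11 * (-symEval a b symTrace - 1 * b ^ 11) ^ 11
      - b ^ 11 * (-symEval a b symTrace - 1 * a ^ 11) ^ 11 = 0 := by
    have h1 : -symEval a b symTrace - 1 * b ^ 11 =
        -(b * ∑ i ∈ Finset.range 11, a ^ i * b ^ (10 - i)) := by
      simp [symEval_eq, symTrace, Finset.sum_range_succ]
      ring
    have h2 : -symEval a b symTrace - 1 * a ^ 11 =
        -(a * ∑ i ∈ Finset.range 11, a ^ i * b ^ (10 - i)) := by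
      simp [symEval_eq, symTrace, Finset.sum_range_succ]
      ring
    rw [h1, h2]
    ring
  rw [h0] at h
  exact (mul_eq_zero.1 h).resolve_left (sub_ne_zero.2 hab)

theorem eq_of_thueForm_eq_zero {a b : ℝ} {P q : ℤ} (hP : (P : ℝ) = a ^ 11 + b ^ 11)
    (hq : (q : ℝ) = a ^ 11 * b ^ 11) (hab : a ≠ b) {x x' : ℝ}
    (hx : thueForm (P : ℝ) q x 1 = 0) (hx' : thueForm (P : ℝ) q x' 1 = 0) : x = x' := by
  have hodd : Odd 11 := by decide
  have key : ∀ {z : ℝ}, thueForm (P : ℝ) q z 1 = 0 →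
      z * (a - b) = a * b ^ 11 - b * a ^ 11 := by
    intro z hz
    have h := sub_mul_thueForm (a ^ 11) (b ^ 11) z 1
    rw [← hP, ← hq, hz, mul_zero] at h
    have h1 : (a * (z - b ^ 11)) ^ 11 = (b * (z - a ^ 11)) ^ 11 := by
      rw [mul_pow, mul_pow]
      linarith
    have h2 := hodd.strictMono_pow.injective h1
    linarith
  exact mul_right_cancel₀ (sub_ne_zero.2 hab) ((key hx).trans (key hx').symm)

open Polynomial in
theorem aeval_thuePoly {R : Type*} [CommRing R] (P q : ℤ) (z : R) :
    aeval z (thuePoly P q) = thueForm (P : R) q z 1 := by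
  rw [thuePoly, ← AlgHom.coe_toRingHom, map_thueForm]
  simp

open Polynomial in
theorem minpoly_of_thueForm_eq_zero {P : ℤ} (hP : ¬ (5 : ℤ) ∣ P) {ν : ℝ}
    (hν : thueForm (P : ℝ) (5 : ℤ) ν 1 = 0) :
    minpoly ℚ ν = (thuePoly P 5).map (algebraMap ℤ ℚ) := by
  refine (minpoly.eq_of_irreducible_of_monic ?_ ?_ ?_).symm
  · exact ((thuePoly_monic P 5).irreducible_iff_irreducible_map_fraction_map).1
      (thuePoly_irreducible hP)
  · rw [aeval_map_algebraMap, aeval_thuePoly, hν]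
  · exact (thuePoly_monic P 5).map _

open Polynomial in
theorem isIntegral_of_thueForm_eq_zero {P q : ℤ} {ν : ℝ}
    (hν : thueForm (P : ℝ) q ν 1 = 0) : IsIntegral ℤ ν :=
  ⟨thuePoly P q, thuePoly_monic P q, by rw [← aeval_def, aeval_thuePoly, hν]⟩

open IntermediateField in
theorem finrank_of_thueForm_eq_zero {P : ℤ} (hP : ¬ (5 : ℤ) ∣ P) {ν : ℝ}
    (hν : thueForm (P : ℝ) (5 : ℤ) ν 1 = 0) : Module.finrank ℚ ℚ⟮ν⟯ = 11 := by
  have hintegral : IsIntegral ℚ ν := (isIntegral_of_thueForm_eq_zero hν).tower_top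
  rw [adjoin.finrank hintegral, minpoly_of_thueForm_eq_zero hP hν,
    (thuePoly_monic P 5).natDegree_map, thuePoly_natDegree]

/-- A real number field of degree eleven generated by the unique real root of the form has unit
rank five. -/
theorem unitsRank_of_finrank_eq_eleven {K : IntermediateField ℚ ℝ} [NumberField K]
    (hK : Module.finrank ℚ K = 11) (huniq : ∀ φ ψ : K →+* ℝ, φ = ψ) :
    NumberField.Units.rank K = 5 := by
  have h1 := NumberField.InfinitePlace.card_add_two_mul_card_eq_rank K
  have h2 : NumberField.InfinitePlace.nrRealPlaces K ≤ 1 := by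
    classical
    rw [← NumberField.InfinitePlace.card_real_embeddings]
    refine Fintype.card_le_one_iff.2 fun φ ψ ↦ Subtype.ext ?_
    have h := huniq φ.2.embedding ψ.2.embedding
    ext z
    rw [← NumberField.ComplexEmbedding.IsReal.coe_embedding_apply φ.2,
      ← NumberField.ComplexEmbedding.IsReal.coe_embedding_apply ψ.2, h]
  have h3 := NumberField.InfinitePlace.card_eq_nrRealPlaces_add_nrComplexPlaces K
  rw [NumberField.Units.rank, h3]
  omega

open IntermediateField Polynomial in
theorem ringHom_ext_of_thueForm_eq_zero {a b : ℝ} {P q : ℤ} (hP : (P : ℝ) = a ^ 11 + b ^ 11)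
    (hq : (q : ℝ) = a ^ 11 * b ^ 11) (hab : a ≠ b) {ν : ℝ}
    (hν : thueForm (P : ℝ) q ν 1 = 0) (φ ψ : ℚ⟮ν⟯ →+* ℝ) : φ = ψ := by
  have hintegral : IsIntegral ℚ ν := (isIntegral_of_thueForm_eq_zero hν).tower_top
  have hgen : thueForm (P : ℚ⟮ν⟯) q (AdjoinSimple.gen ℚ ν) 1 = 0 := by
    apply (algebraMap ℚ⟮ν⟯ ℝ).injective
    rw [map_thueForm]
    simpa using hν
  have hroot : ∀ χ : ℚ⟮ν⟯ →+* ℝ, thueForm (P : ℝ) q (χ (AdjoinSimple.gen ℚ ν)) 1 = 0 := by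
    intro χ
    have := congrArg χ hgen
    rw [map_thueForm] at this
    simpa using this
  have : φ.toRatAlgHom = ψ.toRatAlgHom := by
    refine (adjoin.powerBasis hintegral).algHom_ext ?_
    rw [adjoin.powerBasis_gen]
    exact eq_of_thueForm_eq_zero hP hq hab (hroot φ) (hroot ψ)
  ext z
  exact DFunLike.congr_fun this z

theorem symEval_add {R : Type*} [CommRing R] (a b : R) (x y : Fin 11 → ℤ) :
    symEval a b (x + y) = symEval a b x + symEval a b y := by
  simp [symEval, add_mul, Finset.sum_add_distrib]

theorem symEval_smul {R : Type*} [CommRing R] (a b : R) (n : ℤ) (x : Fin 11 → ℤ) :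
    symEval a b (n • x) = n * symEval a b x := by
  simp [symEval, Finset.mul_sum, mul_assoc]

theorem symEval_single {R : Type*} [CommRing R] (a b : R) (i : Fin 11) :
    symEval a b (Pi.single i 1) = symBasis a b i := by
  simp [symEval, Pi.single_apply]

theorem symEval_mem_span (a b : ℝ) (x : Fin 11 → ℤ) :
    symEval a b x ∈ Submodule.span ℚ (Set.range (symBasis a b)) := by
  refine Submodule.sum_mem _ fun i _ ↦ ?_
  have h := Submodule.smul_mem _ (x i : ℚ)
    (Submodule.subset_span (R := ℚ) (Set.mem_range_self (f := symBasis a b) i))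
  simpa [Rat.smul_def] using h

/-- The rational span of `symBasis a b`, as an algebra. -/
noncomputable def symAlgebra {a b : ℝ} {P q : ℤ} (hP : (P : ℝ) = a ^ 11 + b ^ 11)
    (hq : (q : ℝ) = a ^ 11 * b ^ 11) : Subalgebra ℚ ℝ :=
  (Submodule.span ℚ (Set.range (symBasis a b))).toSubalgebra
    (by simpa [symEval_single, symBasis] using symEval_mem_span a b (Pi.single 0 1))
    (by
      intro x y hx hy
      induction hx, hy using Submodule.span_induction₂ with
      | mem_mem x y hx hy =>
        obtain ⟨i, rfl⟩ := hx
        obtain ⟨j, rfl⟩ := hy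
        rw [← symEval_single, ← symEval_single, ← symEval_mul hP hq]
        exact symEval_mem_span _ _ _
      | zero_left y hy => simp
      | zero_right x hx => simp
      | add_left x y z _ _ _ h1 h2 => rw [add_mul]; exact add_mem h1 h2
      | add_right x y z _ _ _ h1 h2 => rw [mul_add]; exact add_mem h1 h2
      | smul_left r x y _ _ h => rw [smul_mul_assoc]; exact Submodule.smul_mem _ _ h
      | smul_right r x y _ _ h => rw [mul_smul_comm]; exact Submodule.smul_mem _ _ h)

theorem symBasis_spec {a b : ℝ} {P : ℤ} (hP : (P : ℝ) = a ^ 11 + b ^ 11)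
    (hq : ((5 : ℤ) : ℝ) = a ^ 11 * b ^ 11) (hab : a ^ 11 ≠ b ^ 11) (h5 : ¬ (5 : ℤ) ∣ P) :
    LinearIndependent ℚ (symBasis a b) ∧
      ∀ x, symEval a b x ∈ IntermediateField.adjoin ℚ {-symEval a b symTrace} := by
  set ν := -symEval a b symTrace with hνdef
  have hν := thueForm_neg_symTrace hP hq hab
  have hintegral : IsIntegral ℚ ν := (isIntegral_of_thueForm_eq_zero hν).tower_top
  have hrank := finrank_of_thueForm_eq_zero h5 hν
  have hle : Subalgebra.toSubmodule (IntermediateField.adjoin ℚ {ν}).toSubalgebra ≤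
      Submodule.span ℚ (Set.range (symBasis a b)) := by
    rw [IntermediateField.adjoin_simple_toSubalgebra_of_isAlgebraic hintegral.isAlgebraic]
    have : Algebra.adjoin ℚ {ν} ≤ symAlgebra hP hq := by
      refine Algebra.adjoin_le (Set.singleton_subset_iff.2 ?_)
      exact Submodule.neg_mem _ (symEval_mem_span a b _)
    exact this
  have hfin : FiniteDimensional ℚ (Submodule.span ℚ (Set.range (symBasis a b))) :=
    FiniteDimensional.span_of_finite ℚ (Set.finite_range _)
  have hcard := finrank_range_le_card (R := ℚ) (symBasis a b)
  have hge := Submodule.finrank_mono hle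
  have hrank' : Module.finrank ℚ
    (Subalgebra.toSubmodule (IntermediateField.adjoin ℚ {ν}).toSubalgebra) = 11 := hrank
  have heq := Submodule.eq_of_le_of_finrank_le hle (by
    rw [hrank']
    simpa [Set.finrank] using hcard)
  refine ⟨?_, fun x ↦ ?_⟩
  · rw [linearIndependent_iff_card_eq_finrank_span, Set.finrank, ← heq, hrank', Fintype.card_fin]
  · have h := symEval_mem_span a b x
    rw [← heq] at h
    exact h

theorem symEval_injective {a b : ℝ} (h : LinearIndependent ℚ (symBasis a b)) :
    Function.Injective (symEval a b) := by
  intro x y hxy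
  have h0 : ∑ i, ((x i - y i : ℤ) : ℚ) • symBasis a b i = 0 := by
    have : symEval a b x - symEval a b y = 0 := sub_eq_zero.2 hxy
    simpa [Rat.smul_def, symEval, sub_mul, Finset.sum_sub_distrib] using this
  have h1 := Fintype.linearIndependent_iff.1 h _ h0
  funext i
  have := h1 i
  rw [Int.cast_eq_zero] at this
  omega

/-- In a real number field of unit rank five, six units are multiplicatively dependent, and the
exponents may be taken not all divisible by three. -/
theorem exists_zpow_relation {K : IntermediateField ℚ ℝ} [NumberField K]
    (hK : NumberField.Units.rank K = 5) (v : Fin 6 → (NumberField.RingOfIntegers K)ˣ) :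
    ∃ m : Fin 6 → ℤ, ¬ (∀ i, 3 ∣ m i) ∧ ∏ i, v i ^ m i = 1 := by
  let W : Fin 6 → Additive (NumberField.RingOfIntegers K)ˣ := fun i ↦ Additive.ofMul (v i)
  have hdep : ¬ LinearIndependent ℤ W := by
    intro h
    have := h.fintype_card_le_finrank
    rw [NumberField.Units.finrank_eq, hK, Fintype.card_fin] at this
    omega
  obtain ⟨g, hg, i₀, hi₀⟩ := Fintype.not_linearIndependent_iff.1 hdep
  obtain ⟨m, hm, hgcd⟩ := Finset.univ.extract_gcd g ⟨i₀, Finset.mem_univ _⟩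
  set d := Finset.univ.gcd g
  have hd : d ≠ 0 := by
    intro hd
    exact hi₀ (by rw [hm i₀ (Finset.mem_univ _), hd, zero_mul])
  have htors : (∏ i, v i ^ m i) ^ d = 1 := by
    rw [← Finset.prod_zpow]
    have h1 := congrArg Additive.toMul hg
    simp only [toMul_sum, toMul_zsmul, W, toMul_ofMul, toMul_zero] at h1
    rw [← h1]
    refine Finset.prod_congr rfl fun i hi ↦ ?_
    rw [hm i hi, ← zpow_mul, mul_comm]
  have hfin : IsOfFinOrder (∏ i, v i ^ m i) :=
    isOfFinOrder_iff_zpow_eq_one.2 ⟨d, hd, htors⟩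
  have hsq : (∏ i, v i ^ m i) ^ 2 = 1 := by
    set z := ∏ i, v i ^ m i
    obtain ⟨n, hn, hz⟩ := isOfFinOrder_iff_pow_eq_one.1 hfin
    have hz' : (((z : NumberField.RingOfIntegers K) : K) : ℝ) ^ n = 1 := by
      have := congrArg (fun w : (NumberField.RingOfIntegers K)ˣ ↦
        (((w : NumberField.RingOfIntegers K) : K) : ℝ)) hz
      simpa using this
    have habs : |(((z : NumberField.RingOfIntegers K) : K) : ℝ)| = 1 := by
      refine (pow_eq_one_iff_of_nonneg (abs_nonneg _) hn.ne').1 ?_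
      rw [← abs_pow, hz', abs_one]
    have h2 : (((z : NumberField.RingOfIntegers K) : K) : ℝ) ^ 2 = 1 := by
      rw [← sq_abs, habs, one_pow]
    apply Units.ext
    apply NumberField.RingOfIntegers.ext
    apply Subtype.ext
    simpa using h2
  refine ⟨fun i ↦ 2 * m i, fun h ↦ ?_, ?_⟩
  · have h3 : (3 : ℤ) ∣ Finset.univ.gcd m := Finset.dvd_gcd fun i _ ↦ by
      have : 3 ∣ 2 * m i := h i
      omega
    rw [hgcd] at h3
    omega
  · rw [← hsq, ← Finset.prod_pow]
    refine Finset.prod_congr rfl fun i _ ↦ ?_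
    change v i ^ (2 * m i) = (v i ^ m i) ^ 2
    rw [mul_comm, zpow_mul]
    rfl

/-- `z` is congruent to `1 + 3 ^ k * m` modulo `3 ^ (k + 1)`. -/
def OneUnit {R : Type*} [CommRing R] (k : ℕ) (z m : R) : Prop :=
  (3 : R) ^ (k + 1) ∣ z - (1 + 3 ^ k * m)

theorem OneUnit.one {R : Type*} [CommRing R] (k : ℕ) : OneUnit k (1 : R) 0 := by
  simp [OneUnit]

theorem OneUnit.mul {R : Type*} [CommRing R] {k : ℕ} (hk : k ≠ 0) {z z' m m' : R}
    (h : OneUnit k z m) (h' : OneUnit k z' m') : OneUnit k (z * z') (m + m') := by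
  obtain ⟨k, rfl⟩ := Nat.exists_eq_add_one_of_ne_zero hk
  obtain ⟨r, hr⟩ := h
  obtain ⟨r', hr'⟩ := h'
  rw [sub_eq_iff_eq_add] at hr hr'
  refine ⟨r * z' + (1 + 3 ^ (k + 1) * m) * r' + 3 ^ k * m * m', ?_⟩
  rw [hr, hr']
  ring

theorem OneUnit.inv {R : Type*} [CommRing R] {k : ℕ} (hk : k ≠ 0) {z : Rˣ} {m : R}
    (h : OneUnit k (z : R) m) : OneUnit k ((z⁻¹ : Rˣ) : R) (-m) := by
  have h1 : (3 : R) ^ (k + 1) ∣ z * (((z⁻¹ : Rˣ) : R) - (1 + 3 ^ k * (-m))) := by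
    obtain ⟨k, rfl⟩ := Nat.exists_eq_add_one_of_ne_zero hk
    obtain ⟨r, hr⟩ := h
    rw [sub_eq_iff_eq_add] at hr
    refine ⟨-r * (1 + 3 ^ (k + 1) * -m) + 3 ^ k * m * m, ?_⟩
    rw [mul_sub, Units.mul_inv, hr]
    ring
  have h2 := h1.mul_left ((z⁻¹ : Rˣ) : R)
  rwa [Units.inv_mul_cancel_left] at h2

theorem OneUnit.zpow {R : Type*} [CommRing R] {k : ℕ} (hk : k ≠ 0) {z : Rˣ} {m : R}
    (h : OneUnit k (z : R) m) (n : ℤ) : OneUnit k ((z ^ n : Rˣ) : R) (n * m) := by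
  induction n using Int.induction_on with
  | zero => simpa using OneUnit.one k
  | succ n ih =>
    rw [zpow_add_one, Units.val_mul]
    convert ih.mul hk h using 1
    push_cast
    ring
  | pred n ih =>
    rw [zpow_sub_one, Units.val_mul]
    convert ih.mul hk (h.inv hk) using 1
    push_cast
    ring

theorem OneUnit.prod {R ι : Type*} [CommRing R] {k : ℕ} (hk : k ≠ 0) (s : Finset ι)
    {v : ι → Rˣ} {w : ι → R} (h : ∀ i ∈ s, OneUnit k (v i : R) (w i)) (n : ι → ℤ) :
    OneUnit k ((∏ i ∈ s, v i ^ n i : Rˣ) : R) (∑ i ∈ s, n i * w i) := by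
  classical
  induction s using Finset.induction_on with
  | empty => simpa using OneUnit.one k
  | insert i s hi ih =>
    rw [Finset.prod_insert hi, Finset.sum_insert hi, Units.val_mul]
    exact ((h i (Finset.mem_insert_self _ _)).zpow hk _).mul hk
      (ih fun j hj ↦ h j (Finset.mem_insert_of_mem hj))

theorem OneUnit.cube {R : Type*} [CommRing R] {k : ℕ} (hk : k ≠ 0) {z m : R}
    (h : OneUnit k z m) : OneUnit (k + 1) (z ^ 3) m := by
  obtain ⟨k, rfl⟩ := Nat.exists_eq_add_one_of_ne_zero hk
  obtain ⟨r, hr⟩ := h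
  rw [sub_eq_iff_eq_add] at hr
  have hz : z = 1 + 3 ^ (k + 1) * (m + 3 * r) := by
    rw [hr]
    ring
  refine ⟨r + 3 ^ k * (m + 3 * r) ^ 2 + 3 ^ (2 * k) * (m + 3 * r) ^ 3, ?_⟩
  rw [hz]
  ring

theorem OneUnit.dvd_of_eq_one {R : Type*} [CommRing R] [IsDomain R] (h3 : (3 : R) ≠ 0) {k : ℕ}
    {m : R} (h : OneUnit k 1 m) : 3 ∣ m := by
  have h1 : (3 : R) ^ k * 3 ∣ 3 ^ k * m := by
    rw [← dvd_neg, ← pow_succ]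
    have := h
    rw [OneUnit] at this
    convert this using 1
    ring
  exact (mul_dvd_mul_iff_left (pow_ne_zero _ h3)).1 h1

/-- Skolem's lemma: units congruent to `1` modulo powers of `3` whose logarithmic derivatives are
independent modulo `3` satisfy only relations with exponents divisible by `3`. -/
theorem dvd_exponents_of_relation {R : Type*} [CommRing R] [IsDomain R] (h3 : (3 : R) ≠ 0)
    {r : ℕ} (u : Rˣ) (w : R) (ℓ : Fin r → R)
    (hind : ∀ (n₀ : ℤ) (n : Fin r → ℤ), 3 ∣ n₀ * w + ∑ i, n i * ℓ i → 3 ∣ n₀ ∧ ∀ i, 3 ∣ n i)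
    (d : ℕ) : ∀ (k : ℕ), k ≠ 0 → OneUnit (k + d) (u : R) w →
      ∀ (v : Fin r → Rˣ), (∀ i, OneUnit k (v i : R) (ℓ i)) → ∀ (n₀ : ℤ) (n : Fin r → ℤ),
        u ^ n₀ * ∏ i, v i ^ n i = 1 → 3 ∣ n₀ ∧ ∀ i, 3 ∣ n i := by
  induction d with
  | zero =>
    intro k hk hu v hv n₀ n hrel
    refine hind n₀ n (OneUnit.dvd_of_eq_one h3 (k := k) ?_)
    rw [← Units.val_one, ← hrel, Units.val_mul]
    exact (hu.zpow hk n₀).mul hk (OneUnit.prod hk _ (fun i _ ↦ hv i) n)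
  | succ d ih =>
    intro k hk hu v hv n₀ n hrel
    have hu' : OneUnit k (u : R) 0 := by
      obtain ⟨s, hs⟩ := hu
      rw [sub_eq_iff_eq_add] at hs
      refine ⟨3 ^ (d + 1) * s + 3 ^ d * w, ?_⟩
      rw [hs]
      ring
    have h1 : (3 : R) ∣ n₀ * 0 + ∑ i, n i * ℓ i := by
      refine OneUnit.dvd_of_eq_one h3 (k := k) ?_
      rw [← Units.val_one, ← hrel, Units.val_mul]
      exact (hu'.zpow hk n₀).mul hk (OneUnit.prod hk _ (fun i _ ↦ hv i) n)
    have h2 : ∀ i, 3 ∣ n i := (hind 0 n (by simpa using h1)).2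
    choose n' hn' using h2
    refine ⟨(ih (k + 1) k.succ_ne_zero (by rwa [add_right_comm, add_assoc])
      (fun i ↦ v i ^ 3) (fun i ↦ ?_) n₀ n' ?_).1, fun i ↦ ⟨n' i, hn' i⟩⟩
    · rw [Units.val_pow_eq_pow_val]
      exact (hv i).cube hk
    · rw [← hrel]
      congr 1
      refine Finset.prod_congr rfl fun i _ ↦ ?_
      rw [hn' i, zpow_mul]
      rfl

theorem exists_zpow_relation_real {K : IntermediateField ℚ ℝ} [NumberField K]
    (hK : NumberField.Units.rank K = 5) (v v' : Fin 6 → ℝ) (hmul : ∀ i, v i * v' i = 1)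
    (hv : ∀ i, v i ∈ K ∧ IsIntegral ℤ (v i)) (hv' : ∀ i, v' i ∈ K ∧ IsIntegral ℤ (v' i)) :
    ∃ m : Fin 6 → ℤ, ¬ (∀ i, 3 ∣ m i) ∧ ∏ i, v i ^ m i = 1 := by
  have hintegral : ∀ {z : ℝ} (hz : z ∈ K), IsIntegral ℤ z → IsIntegral ℤ (⟨z, hz⟩ : K) :=
    fun hz h ↦ (isIntegral_algHom_iff (K.val.restrictScalars ℤ) Subtype.val_injective).1 h
  let V : Fin 6 → (NumberField.RingOfIntegers K)ˣ := fun i ↦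
    ⟨⟨⟨v i, (hv i).1⟩, hintegral _ (hv i).2⟩, ⟨⟨v' i, (hv' i).1⟩, hintegral _ (hv' i).2⟩,
      NumberField.RingOfIntegers.ext (Subtype.ext (hmul i)),
      NumberField.RingOfIntegers.ext (Subtype.ext ((mul_comm _ _).trans (hmul i)))⟩
  obtain ⟨m, hm, h⟩ := exists_zpow_relation hK V
  refine ⟨m, hm, ?_⟩
  let f : NumberField.RingOfIntegers K →+* ℝ :=
    (algebraMap K ℝ).comp (algebraMap (NumberField.RingOfIntegers K) K)
  have h1 := congrArg (fun z ↦ ((Units.map f.toMonoidHom z : ℝˣ) : ℝ)) h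
  simp only [map_prod, map_zpow, map_one, Units.coe_prod, Units.val_zpow_eq_zpow_val,
    Units.val_one] at h1
  exact h1

/-- The localisation at `3` of the ring of integral combinations of `symBasis a b`. -/
def symRing {a b : ℝ} {P q : ℤ} (hP : (P : ℝ) = a ^ 11 + b ^ 11)
    (hq : (q : ℝ) = a ^ 11 * b ^ 11) : Subring ℝ where
  carrier := {z | ∃ n : ℤ, ¬ 3 ∣ n ∧ ∃ x, n * z = symEval a b x}
  mul_mem' := by
    rintro z z' ⟨n, hn, x, hx⟩ ⟨n', hn', x', hx'⟩
    refine ⟨n * n', fun h ↦ (Int.prime_three.dvd_or_dvd h).elim hn hn', symMul P q x x', ?_⟩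
    rw [symEval_mul hP hq, ← hx, ← hx']
    push_cast
    ring
  one_mem' := ⟨1, by decide, Pi.single 0 1, by simp [symEval_single, symBasis]⟩
  add_mem' := by
    rintro z z' ⟨n, hn, x, hx⟩ ⟨n', hn', x', hx'⟩
    refine ⟨n * n', fun h ↦ (Int.prime_three.dvd_or_dvd h).elim hn hn', n' • x + n • x', ?_⟩
    rw [symEval_add, symEval_smul, symEval_smul, ← hx, ← hx']
    push_cast
    ring
  zero_mem' := ⟨1, by decide, 0, by simp [symEval]⟩
  neg_mem' := by
    rintro z ⟨n, hn, x, hx⟩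
    refine ⟨n, hn, (-1 : ℤ) • x, ?_⟩
    rw [symEval_smul, ← hx]
    push_cast
    ring

section

variable {a b : ℝ} {P q : ℤ} (hP : (P : ℝ) = a ^ 11 + b ^ 11) (hq : (q : ℝ) = a ^ 11 * b ^ 11)

/-- `symEval` with values in `symRing`. -/
def symMk (x : Fin 11 → ℤ) : symRing hP hq := ⟨symEval a b x, 1, by decide, x, by simp⟩

theorem symMk_mul (x y : Fin 11 → ℤ) :
    symMk hP hq (symMul P q x y) = symMk hP hq x * symMk hP hq y :=
  Subtype.ext (symEval_mul hP hq x y)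

theorem symMk_add (x y : Fin 11 → ℤ) : symMk hP hq (x + y) = symMk hP hq x + symMk hP hq y :=
  Subtype.ext (symEval_add a b x y)

theorem symMk_smul (n : ℤ) (x : Fin 11 → ℤ) : symMk hP hq (n • x) = n * symMk hP hq x :=
  Subtype.ext (by simpa [symMk] using symEval_smul a b n x)

theorem symMk_sum {r : ℕ} (n : Fin r → ℤ) (x : Fin r → Fin 11 → ℤ) :
    symMk hP hq (∑ i, n i • x i) = ∑ i, n i * symMk hP hq (x i) := by
  have h : ∀ s : Finset (Fin r),
      symMk hP hq (∑ i ∈ s, n i • x i) = ∑ i ∈ s, n i * symMk hP hq (x i) := by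
    intro s
    classical
    induction s using Finset.induction_on with
    | empty => exact Subtype.ext (by simp [symMk, symEval])
    | insert i s hi ih =>
      rw [Finset.sum_insert hi, Finset.sum_insert hi, symMk_add, symMk_smul, ih]
  exact h _

theorem symMk_congr {n : ℤ} {x y : Fin 11 → ℤ} (h : ∀ i, n ∣ x i - y i) :
    (n : symRing hP hq) ∣ symMk hP hq x - symMk hP hq y := by
  choose z hz using h
  refine ⟨symMk hP hq z, ?_⟩
  rw [sub_eq_iff_eq_add, ← symMk_smul, ← symMk_add]
  congr 1
  funext i
  have := hz i
  simp only [Pi.add_apply, Pi.smul_apply, smul_eq_mul]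
  omega

theorem three_dvd_of_dvd_symMk (hind : LinearIndependent ℚ (symBasis a b)) {x : Fin 11 → ℤ}
    (h : 3 ∣ symMk hP hq x) (i : Fin 11) : 3 ∣ x i := by
  obtain ⟨⟨s, n, hn, y, hy⟩, hs⟩ := h
  have h1 : symEval a b x = 3 * s := congrArg Subtype.val hs
  have h2 : n • x = (3 : ℤ) • y := by
    apply symEval_injective hind
    rw [symEval_smul, symEval_smul, h1, ← hy]
    push_cast
    ring
  have h3 : n * x i = 3 * y i := congrFun h2 i
  exact (Int.prime_three.dvd_or_dvd ⟨y i, h3⟩).resolve_left hn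

end

/-- The natural number with the given digits in base sixteen. -/
def packList : List ℕ → ℕ
  | [] => 0
  | r :: l => r + 16 * packList l

theorem packList_digit {l : List ℕ} (hl : ∀ r ∈ l, r < 16) (i : ℕ) :
    packList l / 16 ^ i % 16 = l.getD i 0 := by
  induction l generalizing i with
  | nil => simp [packList]
  | cons r l ih =>
    have hr := hl r List.mem_cons_self
    cases i with
    | zero => simp only [packList, List.getD_cons_zero]; omega
    | succ i =>
      rw [List.getD_cons_succ, ← ih (fun x hx ↦ hl x (List.mem_cons_of_mem _ hx)), pow_succ',
        ← Nat.div_div_eq_div_mul, packList]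
      congr 2
      omega

/-- Residues modulo nine of a vector, packed into a natural number in base sixteen. -/
def packVec (x : Fin 11 → ℤ) : ℕ :=
  packList (List.ofFn fun i ↦ (x i % 9).toNat)

/-- The vector with given packed residues. -/
def unpackVec (n : ℕ) (i : Fin 11) : ℤ := (n / 16 ^ (i : ℕ) % 16 : ℕ)

theorem unpackVec_packVec (x : Fin 11 → ℤ) (i : Fin 11) : 9 ∣ unpackVec (packVec x) i - x i := by
  have h : ∀ j, (x j % 9).toNat < 16 := by omega
  rw [unpackVec, packVec, packList_digit]
  · rw [List.getD_eq_getElem _ _ (by simp), List.getElem_ofFn]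
    change 9 ∣ ((x i % 9).toNat : ℤ) - x i
    omega
  · intro r hr
    obtain ⟨j, rfl⟩ := (List.mem_ofFn' _ _).1 hr
    exact h j

/-- A square-and-multiply program run on packed vectors: `false` squares, `true` multiplies by the
base. -/
def powVec (P q : ℤ) (base : ℕ) : List Bool → ℕ → ℕ
  | [], n => n
  | _, 0 => 0
  | false :: l, k + 1 =>
    powVec P q base l (packVec (symMul P q (unpackVec (k + 1)) (unpackVec (k + 1))))
  | true :: l, k + 1 =>
    powVec P q base l (packVec (symMul P q (unpackVec (k + 1)) (unpackVec base)))

/-- The exponent computed by a square-and-multiply program. -/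
def powExp : List Bool → ℕ → ℕ
  | [], e => e
  | false :: l, e => powExp l (2 * e)
  | true :: l, e => powExp l (e + 1)

theorem powVec_zero (P q : ℤ) (base : ℕ) (l : List Bool) : powVec P q base l 0 = 0 := by
  cases l <;> simp [powVec]

theorem powVec_spec {a b : ℝ} {P q : ℤ} (hP : (P : ℝ) = a ^ 11 + b ^ 11)
    (hq : (q : ℝ) = a ^ 11 * b ^ 11) {base : ℕ} {z : symRing hP hq}
    (hz : 9 ∣ z - symMk hP hq (unpackVec base)) (l : List Bool) :
    ∀ (n e : ℕ), 9 ∣ z ^ e - symMk hP hq (unpackVec n) → powVec P q base l n ≠ 0 →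
      9 ∣ z ^ powExp l e - symMk hP hq (unpackVec (powVec P q base l n)) := by
  have key : ∀ x y : Fin 11 → ℤ, ∀ z z' : symRing hP hq, 9 ∣ z - symMk hP hq x →
      9 ∣ z' - symMk hP hq y →
      9 ∣ z * z' - symMk hP hq (unpackVec (packVec (symMul P q x y))) := by
    intro x y z z' hx hy
    have h1 := symMk_congr hP hq (unpackVec_packVec (symMul P q x y))
    rw [symMk_mul] at h1
    have h2 := (hx.mul_right z').add (hy.mul_left (symMk hP hq x))
    push_cast at h1
    have h3 := dvd_sub h2 h1
    convert h3 using 1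
    ring
  induction l with
  | nil => intro n e h _; simpa [powVec, powExp] using h
  | cons i l ih =>
    intro n e h hne
    rcases n with _ | k
    · rw [powVec_zero] at hne
      exact absurd rfl hne
    cases i with
    | false =>
      simp only [powVec, powExp] at hne ⊢
      refine ih _ _ ?_ hne
      rw [two_mul, pow_add]
      exact key _ _ _ _ h h
    | true =>
      simp only [powVec, powExp] at hne ⊢
      refine ih _ _ ?_ hne
      rw [pow_succ]
      exact key _ _ _ _ h hz

theorem isIntegral_of_add_of_mul {x y : ℝ} {P q : ℤ} (hP : (P : ℝ) = x + y)
    (hq : (q : ℝ) = x * y) : IsIntegral ℤ x := by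
  refine ⟨Polynomial.X ^ 2 - Polynomial.C P * Polynomial.X + Polynomial.C q, ?_, ?_⟩
  · monicity!
  · rw [← Polynomial.aeval_def]
    simp [hP, hq]
    ring

theorem exists_pow_eleven_add_mul {P q : ℤ} (hP : 0 < P) (hq : 0 < q) (hPq : 4 * q < P ^ 2) :
    ∃ a b : ℝ, (P : ℝ) = a ^ 11 + b ^ 11 ∧ (q : ℝ) = a ^ 11 * b ^ 11 ∧ a ^ 11 ≠ b ^ 11 ∧
      IsIntegral ℤ a ∧ IsIntegral ℤ b := by
  have hP' : (0 : ℝ) < P := by exact_mod_cast hP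
  have hq' : (0 : ℝ) < q := by exact_mod_cast hq
  have hPq' : (4 : ℝ) * q < P ^ 2 := by exact_mod_cast hPq
  set δ := Real.sqrt (P ^ 2 - 4 * q)
  have hδ : 0 < δ := Real.sqrt_pos.2 (by linarith)
  have hδ2 : δ ^ 2 = P ^ 2 - 4 * q := Real.sq_sqrt (by linarith)
  have hδP : δ < P := by nlinarith
  have root : ∀ z : ℝ, 0 < z → ∃ r : ℝ, r ^ 11 = z := fun z hz ↦
    ⟨z ^ ((11 : ℕ) : ℝ)⁻¹, Real.rpow_inv_natCast_pow hz.le (by norm_num)⟩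
  obtain ⟨a, ha⟩ := root ((P + δ) / 2) (by linarith)
  obtain ⟨b, hb⟩ := root ((P - δ) / 2) (by linarith)
  have h1 : (P : ℝ) = a ^ 11 + b ^ 11 := by rw [ha, hb]; ring
  have h2 : (q : ℝ) = a ^ 11 * b ^ 11 := by rw [ha, hb]; linarith
  refine ⟨a, b, h1, h2, ?_, ?_, ?_⟩
  · rw [ha, hb]
    intro h
    linarith
  · exact (isIntegral_of_add_of_mul h1 h2).of_pow (by norm_num)
  · exact (isIntegral_of_add_of_mul (h1.trans (add_comm _ _))
      (h2.trans (mul_comm _ _))).of_pow (by norm_num)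

/-- Change of coordinates from the basis in which the last five vectors are replaced by
`(g * X + s * Y) / H`, with `X` and `Y` the elements of `symBasis` of opposite index, scaled
by `H`. -/
def liftVec (g s H : ℤ) (v : Fin 11 → ℤ) : Fin 11 → ℤ :=
  ![H * v 0, H * v 1 + g * v 6, H * v 2 + g * v 7, H * v 3 + g * v 8, H * v 4 + g * v 9,
    H * v 5 + g * v 10, s * v 10, s * v 9, s * v 8, s * v 7, s * v 6]

theorem isIntegral_liftVec {a b : ℝ} {P q g s H T M : ℤ} (hP : (P : ℝ) = a ^ 11 + b ^ 11)
    (hq : (q : ℝ) = a ^ 11 * b ^ 11) (ha : IsIntegral ℤ a) (hb : IsIntegral ℤ b) (hH : H ≠ 0)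
    (hT : 2 * g + s * P = H * T) (hM : g ^ 2 + g * s * P + s ^ 2 * q = H ^ 2 * M)
    (v : Fin 11 → ℤ) : IsIntegral ℤ (symEval a b (liftVec g s H v) / H) := by
  have hH' : (H : ℝ) ≠ 0 := Int.cast_ne_zero.2 hH
  obtain ⟨α, hα⟩ : ∃ α : ℝ, H * α = g + s * a ^ 11 := ⟨(g + s * a ^ 11) / H, by field_simp⟩
  obtain ⟨β, hβ⟩ : ∃ β : ℝ, H * β = g + s * b ^ 11 := ⟨(g + s * b ^ 11) / H, by field_simp⟩
  have hT' : (T : ℝ) = α + β := by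
    apply mul_left_cancel₀ hH'
    have : (2 * g + s * P : ℝ) = H * T := by exact_mod_cast hT
    rw [← this, mul_add, hα, hβ, hP]
    ring
  have hM' : (M : ℝ) = α * β := by
    apply mul_left_cancel₀ (pow_ne_zero 2 hH')
    have : (g ^ 2 + g * s * P + s ^ 2 * q : ℝ) = H ^ 2 * M := by exact_mod_cast hM
    rw [← this, show (H : ℝ) ^ 2 * (α * β) = (H * α) * (H * β) by ring, hα, hβ, hP, hq]
    ring
  have hαi : IsIntegral ℤ α := isIntegral_of_add_of_mul hT' hM'
  have hβi : IsIntegral ℤ β := isIntegral_of_add_of_mul (hT'.trans (add_comm _ _))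
    (hM'.trans (mul_comm _ _))
  have heq : symEval a b (liftVec g s H v) / H = v 0 + v 1 * (a ^ 6 * b ^ 5 + a ^ 5 * b ^ 6)
      + v 2 * (a ^ 7 * b ^ 4 + a ^ 4 * b ^ 7) + v 3 * (a ^ 8 * b ^ 3 + a ^ 3 * b ^ 8)
      + v 4 * (a ^ 9 * b ^ 2 + a ^ 2 * b ^ 9) + v 5 * (a ^ 10 * b + a * b ^ 10)
      + v 6 * (α * (a ^ 5 * b ^ 6) + β * (a ^ 6 * b ^ 5))
      + v 7 * (α * (a ^ 4 * b ^ 7) + β * (a ^ 7 * b ^ 4))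
      + v 8 * (α * (a ^ 3 * b ^ 8) + β * (a ^ 8 * b ^ 3))
      + v 9 * (α * (a ^ 2 * b ^ 9) + β * (a ^ 9 * b ^ 2))
      + v 10 * (α * (a * b ^ 10) + β * (a ^ 10 * b)) := by
    rw [div_eq_iff hH', symEval_eq]
    simp only [liftVec, Matrix.cons_val, Int.cast_add, Int.cast_mul]
    linear_combination
      (-(v 6 * (a ^ 5 * b ^ 6)) - v 7 * (a ^ 4 * b ^ 7) - v 8 * (a ^ 3 * b ^ 8)
        - v 9 * (a ^ 2 * b ^ 9) - v 10 * (a * b ^ 10)) * hα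
      + (-(v 6 * (a ^ 6 * b ^ 5)) - v 7 * (a ^ 7 * b ^ 4) - v 8 * (a ^ 8 * b ^ 3)
        - v 9 * (a ^ 9 * b ^ 2) - v 10 * (a ^ 10 * b)) * hβ
  rw [heq]
  have hmem : ∀ {z : ℝ}, IsIntegral ℤ z ↔ z ∈ integralClosure ℤ ℝ := Iff.rfl
  rw [hmem] at *
  have hintegral : ∀ n : ℤ, (n : ℝ) ∈ integralClosure ℤ ℝ := fun n ↦ intCast_mem _ n
  have ht : ∀ (n : ℤ) {c d : ℝ}, c ∈ integralClosure ℤ ℝ → d ∈ integralClosure ℤ ℝ →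
      ∀ i j k l : ℕ, (n : ℝ) * (c * (a ^ i * b ^ j) + d * (a ^ k * b ^ l)) ∈
        integralClosure ℤ ℝ := fun n c d hc hd i j k l ↦
    mul_mem (hintegral n) (add_mem (mul_mem hc (mul_mem (pow_mem ha _) (pow_mem hb _)))
      (mul_mem hd (mul_mem (pow_mem ha _) (pow_mem hb _))))
  have h1 : (1 : ℝ) ∈ integralClosure ℤ ℝ := one_mem _
  refine add_mem (add_mem (add_mem (add_mem (add_mem (add_mem (add_mem (add_mem (add_mem (add_mem
    (hintegral _) ?_) ?_) ?_) ?_) ?_) ?_) ?_) ?_) ?_) ?_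
  · simpa using ht (v 1) h1 h1 6 5 5 6
  · simpa using ht (v 2) h1 h1 7 4 4 7
  · simpa using ht (v 3) h1 h1 8 3 3 8
  · simpa using ht (v 4) h1 h1 9 2 2 9
  · simpa using ht (v 5) h1 h1 10 1 1 10
  · exact ht (v 6) hαi hβi 5 6 6 5
  · exact ht (v 7) hαi hβi 4 7 7 4
  · exact ht (v 8) hαi hβi 3 8 8 3
  · exact ht (v 9) hαi hβi 2 9 9 2
  · simpa using ht (v 10) hαi hβi 1 10 10 1

/-- Certificate that `v` and `v'` are the coordinates of inverse units, and that the power of the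
first one given by the program `prog` is `1 + 3 * l` modulo nine; here `k * H` is to be `1` modulo
nine. -/
def unitCheck (P q g s H k : ℤ) (prog : List Bool) (v v' l : Fin 11 → ℤ) : Bool :=
  let x := liftVec g s H v
  let base := packVec (k • x)
  let r := powVec P q base prog base
  decide (∀ i, symMul P q x (liftVec g s H v') i = if i = 0 then H ^ 2 else 0) &&
    (r != 0 && decide (∀ i, (unpackVec r i - (3 * l i + if i = 0 then 1 else 0)) % 9 = 0))

theorem unit_of_unitCheck {a b : ℝ} {P q g s H k : ℤ} (hP : (P : ℝ) = a ^ 11 + b ^ 11)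
    (hq : (q : ℝ) = a ^ 11 * b ^ 11) (hH : H ≠ 0) (hk : 9 ∣ k * H - 1) {prog : List Bool}
    {v v' l : Fin 11 → ℤ} (h : unitCheck P q g s H k prog v v' l = true) :
    ∃ ε : (symRing hP hq)ˣ, ((ε : symRing hP hq) : ℝ) = symEval a b (liftVec g s H v) / H ∧
      ((ε⁻¹ : (symRing hP hq)ˣ) : symRing hP hq) = symEval a b (liftVec g s H v') / H ∧
      OneUnit 1 ((ε : symRing hP hq) ^ powExp prog 1) (symMk hP hq l) := by
  simp only [unitCheck, Bool.and_eq_true, decide_eq_true_eq, bne_iff_ne] at h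
  obtain ⟨h1, h2, h3⟩ := h
  set x := liftVec g s H v
  set x' := liftVec g s H v'
  have hH' : (H : ℝ) ≠ 0 := Int.cast_ne_zero.2 hH
  have hH3 : ¬ (3 : ℤ) ∣ H := fun h ↦ by
    have : (3 : ℤ) ∣ k * H := h.mul_left k
    omega
  have hmem : ∀ y, symEval a b y / H ∈ symRing hP hq := fun y ↦
    ⟨H, hH3, y, by field_simp⟩
  have hmul : symEval a b x / H * (symEval a b x' / H) = 1 := by
    have : symMul P q x x' = H ^ 2 • Pi.single 0 1 := by
      funext i
      rw [h1 i]
      simp [Pi.single_apply]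
    have h4 := symEval_mul hP hq x x'
    rw [this, symEval_smul, symEval_single] at h4
    rw [div_mul_div_comm, ← h4]
    simp [symBasis]
    field_simp
  refine ⟨⟨⟨_, hmem x⟩, ⟨_, hmem x'⟩, Subtype.ext hmul,
    Subtype.ext ((mul_comm _ _).trans hmul)⟩, rfl, rfl, ?_⟩
  have hone : symMk hP hq (fun i ↦ if i = 0 then 1 else 0) = 1 :=
    Subtype.ext (by simp [symMk, symEval, symBasis])
  have hz : 9 ∣ (⟨_, hmem x⟩ : symRing hP hq) -
      symMk hP hq (unpackVec (packVec (k • x))) := by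
    have h4 := symMk_congr hP hq (unpackVec_packVec (k • x))
    obtain ⟨c, hc⟩ := hk
    have h5 : (⟨_, hmem x⟩ : symRing hP hq) - symMk hP hq (k • x) =
        9 * (-c * ⟨_, hmem x⟩) := by
      rw [symMk_smul]
      apply Subtype.ext
      have hc' : (k * H - 1 : ℝ) = 9 * c := by exact_mod_cast hc
      have : symEval a b x = H * (symEval a b x / H) := by field_simp
      have h9 : ((9 : symRing hP hq) : ℝ) = 9 := map_ofNat (symRing hP hq).subtype 9
      push_cast [symMk]
      rw [this, mul_div_cancel_left₀ _ hH']
      linear_combination (-(symEval a b x / H)) * hc' + c * (symEval a b x / H) * h9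
    have h6 := dvd_sub (Dvd.intro _ h5.symm) h4
    convert h6 using 1
    ring
  have h4 := powVec_spec hP hq hz prog _ 1 (by rwa [pow_one]) h2
  have h5 := symMk_congr hP hq (n := 9) (x := unpackVec _) (y := (3 : ℤ) • l +
    fun i ↦ if i = 0 then 1 else 0) fun i ↦ Int.dvd_of_emod_eq_zero (h3 i)
  rw [symMk_add, symMk_smul, hone] at h5
  have h6 := dvd_add h4 h5
  push_cast at h6
  rw [OneUnit]
  convert h6 using 1
  · norm_num
  · ring

theorem sq_dvd_thueForm_sub (P q S t : ℤ) : t ^ 2 ∣ S ^ 11 - thueForm P q S t := by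
  rw [thueForm, sub_sub_cancel]
  refine Dvd.dvd.mul_left (Finset.dvd_sum fun k _ ↦ ?_) q
  rcases k with _ | k
  · simp [lucasU]
  · exact Dvd.dvd.mul_left ⟨t ^ k, by ring⟩ _

/-- If `S - 1` and `t` are divisible by three then `S` is much closer to `1` than `t` to `0`. -/
theorem exists_eq_three_pow_mul {P q S t : ℤ} (hS : 3 ∣ S - 1) (ht : 3 ∣ t) (ht0 : t ≠ 0)
    (h : thueForm P q S t = 1) :
    ∃ (d : ℕ) (t₀ : ℤ), ¬ 3 ∣ t₀ ∧ t = 3 ^ (1 + d) * t₀ ∧ 3 ^ (1 + d + 1) ∣ S - 1 := by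
  obtain ⟨t₀, hte, ht₀⟩ := (Int.finiteMultiplicity_iff.2
    ⟨by decide, ht0⟩ : FiniteMultiplicity 3 t).exists_eq_pow_mul_and_not_dvd
  generalize multiplicity 3 t = e at hte
  obtain ⟨d, rfl⟩ : ∃ d, e = 1 + d := by
    refine Nat.exists_eq_add_of_le (Nat.one_le_iff_ne_zero.2 ?_)
    rintro rfl
    exact ht₀ (by simpa [hte] using ht)
  refine ⟨d, t₀, ht₀, hte, ?_⟩
  have hdvd : (3 : ℤ) ^ (1 + d + 1) ∣ (S - 1) * ∑ i ∈ Finset.range 11, S ^ i := by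
    rw [mul_geom_sum, ← h]
    refine (Dvd.dvd.trans ?_ (sq_dvd_thueForm_sub P q S t))
    rw [hte, mul_pow, ← pow_mul]
    exact (pow_dvd_pow 3 (by lia)).mul_right _
  refine (IsCoprime.pow_left ?_).dvd_of_dvd_mul_right hdvd
  refine (Int.prime_three.coprime_iff_not_dvd).2 fun h3 ↦ ?_
  have h11 : (3 : ℤ) ∣ ∑ i ∈ Finset.range 11, S ^ i - 11 := by
    have : ∑ i ∈ Finset.range 11, S ^ i - 11 = ∑ i ∈ Finset.range 11, (S ^ i - 1 ^ i) := by
      simp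
    rw [this]
    exact Finset.dvd_sum fun i _ ↦ hS.trans (sub_dvd_pow_sub_pow S 1 i)
  lia

theorem eq_zero_of_thueForm_eq_one {P g s H k T M : ℤ} {prog : List Bool}
    (hP0 : 0 < P) (hP20 : 20 < P ^ 2) (hP5 : ¬ 5 ∣ P) (hH : H ≠ 0)
    (hT : 2 * g + s * P = H * T) (hM : g ^ 2 + g * s * P + s ^ 2 * 5 = H ^ 2 * M)
    (hk : 9 ∣ k * H - 1) (hprog : ¬ 3 ∣ powExp prog 1) {V V' L : Fin 5 → Fin 11 → ℤ}
    (hcheck : ∀ j, unitCheck P 5 g s H k prog (V j) (V' j) (L j) = true)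
    {F : Fin 6 → Fin 11 → ℤ}
    (hF : ∀ i j, 3 ∣ ∑ c, F i c * (Fin.cons symTrace L : Fin 6 → Fin 11 → ℤ) j c
      - if i = j then 1 else 0)
    {S t : ℤ} (hS : 3 ∣ S - 1) (ht : 3 ∣ t) (h : thueForm P 5 S t = 1) : t = 0 := by
  by_contra ht0
  obtain ⟨d, t₀, ht₀, htd, hSd⟩ := exists_eq_three_pow_mul hS ht ht0 h
  obtain ⟨a, b, hP, hq, hab, hai, hbi⟩ := exists_pow_eleven_add_mul (q := 5) hP0 (by norm_num)
    (by linarith)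
  have hab' : a ≠ b := fun h ↦ hab (by rw [h])
  obtain ⟨hind, hmemK⟩ := symBasis_spec hP hq hab hP5
  have hν := thueForm_neg_symTrace hP hq hab
  set ν := -symEval a b symTrace with hνdef
  have hintegral : IsIntegral ℤ ν := isIntegral_of_thueForm_eq_zero hν
  have hfin : FiniteDimensional ℚ (IntermediateField.adjoin ℚ {ν}) :=
    IntermediateField.adjoin.finiteDimensional hintegral.tower_top
  have hNF : NumberField (IntermediateField.adjoin ℚ {ν}) := ⟨⟩
  have hrank : NumberField.Units.rank (IntermediateField.adjoin ℚ {ν}) = 5 :=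
    unitsRank_of_finrank_eq_eleven (finrank_of_thueForm_eq_zero hP5 hν)
      (ringHom_ext_of_thueForm_eq_zero hP hq hab' hν)
  -- the unit attached to the solution
  have key : ∀ (R : Subring ℝ), ν ∈ R → ∃ z ∈ R, (S - t * ν) * z = 1 := by
    intro R hR
    have h0 : thueForm (P : R) (5 : ℤ) ⟨ν, hR⟩ 1 = 0 := by
      apply R.subtype_injective
      rw [map_thueForm, map_intCast, map_intCast, map_one, map_zero]
      exact hν
    have h1 : thueForm (P : R) (5 : ℤ) S t = 1 := by
      have := congrArg (Int.castRingHom R) h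
      rw [map_thueForm] at this
      simpa using this
    obtain ⟨z, hz⟩ := sub_mul_dvd_thueForm (S := (S : R)) (t := t) h0
    rw [h1] at hz
    refine ⟨z, z.2, ?_⟩
    have := congrArg R.subtype hz
    simpa using this.symm
  obtain ⟨z, hzR, hz⟩ := key (symRing hP hq) (neg_mem (symMk hP hq symTrace).2)
  obtain ⟨z', hzi, hz'⟩ := key (integralClosure ℤ ℝ).toSubring hintegral
  have hzz : z' = z := by
    have h0 : (S - t * ν : ℝ) ≠ 0 := left_ne_zero_of_mul_eq_one hz
    exact mul_left_cancel₀ h0 (hz'.trans hz.symm)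
  rw [hzz] at hzi
  let u : (symRing hP hq)ˣ := ⟨S + t * symMk hP hq symTrace, ⟨z, hzR⟩,
    Subtype.ext (by simpa [symMk, hνdef] using hz),
    Subtype.ext (by simpa [symMk, hνdef, mul_comm] using hz)⟩
  have huval : ((u : symRing hP hq) : ℝ) = S - t * ν := by simp [u, symMk, hνdef]
  have huinv : (((u⁻¹ : (symRing hP hq)ˣ) : symRing hP hq) : ℝ) = z := rfl
  have hu : OneUnit (1 + d) (u : symRing hP hq) (t₀ * symMk hP hq symTrace) := by
    obtain ⟨c, hc⟩ := hSd
    refine ⟨c, ?_⟩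
    have hc' : (S - 1 : symRing hP hq) = 3 ^ (1 + d + 1) * c := by
      exact_mod_cast congrArg (Int.cast : ℤ → symRing hP hq) hc
    have htd' : (t : symRing hP hq) = 3 ^ (1 + d) * t₀ := by
      exact_mod_cast congrArg (Int.cast : ℤ → symRing hP hq) htd
    simp only [u]
    rw [htd']
    linear_combination hc'
  choose ε hε hε' hεL using fun j ↦ unit_of_unitCheck hP hq hH hk (hcheck j)
  have hliftK : ∀ v, symEval a b (liftVec g s H v) / H ∈ IntermediateField.adjoin ℚ {ν} :=
    fun v ↦ div_mem (hmemK _) (intCast_mem _ H)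
  have hlift : ∀ v, IsIntegral ℤ (symEval a b (liftVec g s H v) / H) :=
    isIntegral_liftVec hP hq hai hbi hH hT hM
  have huK : (S - t * ν : ℝ) ∈ IntermediateField.adjoin ℚ {ν} :=
    sub_mem (intCast_mem _ S) (mul_mem (intCast_mem _ t)
      (IntermediateField.mem_adjoin_simple_self ℚ ν))
  have hzK : z ∈ IntermediateField.adjoin ℚ {ν} := by
    rw [eq_inv_of_mul_eq_one_right hz]
    exact inv_mem huK
  have huI : IsIntegral ℤ (S - t * ν : ℝ) := by
    have : (S - t * ν : ℝ) ∈ integralClosure ℤ ℝ :=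
      sub_mem (intCast_mem _ S) (mul_mem (intCast_mem _ t) hintegral)
    exact this
  let w : Fin 6 → (symRing hP hq)ˣ := Fin.cons u ε
  obtain ⟨m, hm, hrel⟩ := exists_zpow_relation_real hrank (fun i ↦ ((w i : symRing hP hq) : ℝ))
    (fun i ↦ (((w i)⁻¹ : (symRing hP hq)ˣ) : symRing hP hq))
    (fun i ↦ congrArg Subtype.val (w i).mul_inv)
    (fun i ↦ by
      refine Fin.cases ?_ (fun j ↦ ?_) i
      · simp only [w, Fin.cons_zero, huval]
        exact ⟨huK, huI⟩
      · simp only [w, Fin.cons_succ, hε]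
        exact ⟨hliftK _, hlift _⟩)
    (fun i ↦ by
      refine Fin.cases ?_ (fun j ↦ ?_) i
      · simp only [w, Fin.cons_zero, huinv]
        exact ⟨hzK, hzi⟩
      · simp only [w, Fin.cons_succ, hε']
        exact ⟨hliftK _, hlift _⟩)
  have hrel' : ∏ i, w i ^ m i = 1 := by
    have hinj := Units.map_injective (f := ((symRing hP hq).subtype : symRing hP hq →* ℝ))
      (symRing hP hq).subtype_injective
    apply hinj
    apply Units.ext
    rw [map_prod, map_one, Units.val_one, Units.coe_prod, ← hrel]
    simp
  rw [Fin.prod_univ_succ] at hrel'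
  simp only [w, Fin.cons_zero, Fin.cons_succ] at hrel'
  have hrelE : u ^ (powExp prog 1 * m 0) * ∏ j : Fin 5, (ε j ^ powExp prog 1) ^ m j.succ = 1 := by
    have := congrArg (· ^ powExp prog 1) hrel'
    simp only [one_pow, mul_pow] at this
    rw [← this, mul_comm (powExp prog 1 : ℤ), zpow_mul, zpow_natCast, ← Finset.prod_pow]
    congr 1
    refine Finset.prod_congr rfl fun j _ ↦ ?_
    rw [← zpow_natCast, ← zpow_natCast, ← zpow_mul, ← zpow_mul, mul_comm]
  have h3 : (3 : symRing hP hq) ≠ 0 := by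
    intro h
    have := congrArg (symRing hP hq).subtype h
    rw [map_ofNat, map_zero] at this
    norm_num at this
  have hfinal := dvd_exponents_of_relation h3 u (t₀ * symMk hP hq symTrace)
    (fun j ↦ symMk hP hq (L j)) ?_ d 1 one_ne_zero hu (fun j ↦ ε j ^ powExp prog 1)
    (fun j ↦ by rw [Units.val_pow_eq_pow_val]; exact hεL j) _ _ hrelE
  · refine hm fun i ↦ Fin.cases ?_ hfinal.2 i
    refine (Int.prime_three.dvd_or_dvd hfinal.1).resolve_left fun h ↦ hprog ?_
    exact_mod_cast h
  · intro n₀ n hn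
    have h4 : (3 : symRing hP hq) ∣ symMk hP hq
        (∑ j, (Fin.cons (n₀ * t₀) n : Fin 6 → ℤ) j •
          (Fin.cons symTrace L : Fin 6 → Fin 11 → ℤ) j) := by
      rw [symMk_sum, Fin.sum_univ_succ]
      simp only [Fin.cons_zero, Fin.cons_succ]
      push_cast
      rwa [mul_assoc]
    have h5 := three_dvd_of_dvd_symMk hP hq hind h4
    have h6 : ∀ i, 3 ∣ (Fin.cons (n₀ * t₀) n : Fin 6 → ℤ) i := by
      intro i
      set N := (Fin.cons (n₀ * t₀) n : Fin 6 → ℤ)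
      set W := (Fin.cons symTrace L : Fin 6 → Fin 11 → ℤ)
      have h7 : (3 : ℤ) ∣ ∑ c, F i c * (∑ j, N j • W j) c :=
        Finset.dvd_sum fun c _ ↦ (h5 c).mul_left _
      have h8 : (3 : ℤ) ∣ ∑ j, N j * (∑ c, F i c * W j c - if i = j then 1 else 0) :=
        Finset.dvd_sum fun j _ ↦ (hF i j).mul_left _
      have h9 : ∑ c, F i c * (∑ j, N j • W j) c -
          ∑ j, N j * (∑ c, F i c * W j c - if i = j then 1 else 0) = N i := by
        simp only [mul_sub, Finset.sum_sub_distrib, Finset.sum_apply, Pi.smul_apply, smul_eq_mul,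
          Finset.mul_sum, mul_ite, mul_one, mul_zero, Finset.sum_ite_eq, Finset.mem_univ, if_true]
        rw [Finset.sum_comm]
        simp only [mul_left_comm, sub_sub_cancel]
      rw [← h9]
      exact dvd_sub h7 h8
    exact ⟨(Int.prime_three.dvd_or_dvd (h6 0)).resolve_right ht₀, fun j ↦ h6 j.succ⟩

theorem eq_zero_of_thueForm_fourteen {S t : ℤ} (hS : 3 ∣ S - 1) (ht : 3 ∣ t)
    (h : thueForm 14 5 S t = 1) : t = 0 := by
  refine eq_zero_of_thueForm_eq_one (P := 14) (g := 1) (s := 1) (H := 2)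
    (k := 5) (T := 8) (M := 5)
    (prog :=
      [false, true, false, true, false, false, false, true, false, true, false, false, true,
        false, false, true, false, false, true, false, false, false])
    (V := ![
      ![-455521756973031, -165912911714708, -102879765117653, -51061851481833, -4810344019775,
        40916773356140, -10139976582338, -31525319124829, -56347331626506, -87311936407555,
        -127794678267372],
      ![60559511, -18499723, -4549185, 7722339, 8605883, -546391, -2535314, -7420172, -7276680,
        1674787, 12592110],
      ![-100230701590801, 54370473603773, -1680559309103, -29612188779958, -6230547075513,
        25266206563829, -7343996843900, -12821060648650, 9039353177006, 24062120572756,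
        -22263947382921],
      ![76454426938341, -94211970877890, 9534913843058, 49981378774229, -73559126367995,
        62973122321740, 31281117556010, -15578614262514, -16374614592319, 54964624062538,
        -71901391922001],
      ![-873918507640389659803813701, -318303704405151625096607969, -197374867862596226177069744,
        -97962057203613121058835136, -9228679685148729299934629, 78498798418309045927364292,
        -19453566990620260344095153, -60481284421463036704275728, -108102327241046051062611353,
        -167507917094050344081747737, -245173952021885062369165040]])
    (V' := ![
      ![40760279, -9042892, 5986839, 3898193, -918751, -44257, -921779, 3217108, 1359773,
        -7826396, -753439],
      ![-12722365369, 12528465139, 25467418679, 8450285539, -14127239555, -17837502183,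
        -4858208800, -8800940713, -197482638, 14729075735, 17343194563],
      ![-68200661, -32127247, -15538573, 2664745, 11083244, 16068621, 2319629, 7930549, 10517368,
        -9196, -21453249],
      ![213224861980644581, 77662059296699264, 48156917605272076, 23901506499467359,
        2251670582896228, -19152703944133437, 4746414576419887, 14756664673474715,
        26375583218241655, 40869783505334343, 59819321949395840],
      ![-1596104466577283411, -418160178883576348, 154717068272026180, 196802585236870157,
        -52197367196658114, -19810298193340886, -50380937713380771, -25886135747948087,
        175140608905192895, 249463111095816381, -107489264204126782]])
    (L := ![
      ![0, 0, 1, 2, 0, 1, 2, 2, 2, 2, 2],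
      ![0, 1, 0, 0, 0, 1, 2, 1, 0, 0, 1],
      ![0, 0, 0, 2, 2, 0, 0, 1, 1, 1, 0],
      ![0, 1, 1, 0, 0, 2, 1, 0, 2, 2, 1],
      ![0, 0, 1, 2, 1, 0, 0, 2, 1, 1, 2]])
    (F := ![
      ![0, 0, 0, 0, 0, 1, 1, 0, 0, 0, 0],
      ![0, 1, 1, 2, 1, 1, 2, 0, 0, 0, 0],
      ![0, 0, 1, 2, 1, 2, 1, 0, 0, 0, 0],
      ![0, 1, 1, 0, 2, 2, 0, 0, 0, 0, 0],
      ![0, 1, 2, 1, 2, 0, 1, 0, 0, 0, 0],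
      ![0, 1, 1, 0, 0, 1, 2, 0, 0, 0, 0]])
    (by norm_num) (by norm_num) (by norm_num) (by norm_num) (by norm_num) (by norm_num)
    (by norm_num) (by decide) ?_ ?_ hS ht h
  · decide +kernel
  · decide +kernel

theorem eq_zero_of_thueForm_eighteen {S t : ℤ} (hS : 3 ∣ S - 1) (ht : 3 ∣ t)
    (h : thueForm 18 5 S t = 1) : t = 0 := by
  refine eq_zero_of_thueForm_eq_one (P := 18) (g := 1) (s := 1) (H := 2)
    (k := 5) (T := 10) (M := 6)
    (prog :=
      [false, true, false, true, false, true, false, false, false, true, false])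
    (V := ![
      ![23981, -2433, 315, 4287, 3540, 928, -810, -2499, -2048, -1839, 833],
      ![373730581, 187200751, -96125190, -13794221, 78856531, -45707080, -26855481, -8196056,
        61471717, -68834098, 14476353],
      ![-22812338599124699, -116195307681600560, 31132638583945447, 39653949424418162,
        -70517287048783219, 55878932298786326, 26741970769689395, -8198574226493768,
        -25350614982990328, 58165068164671577, -57765388466919252],
      ![-635584665611408725484489, -40822429671757849973806, -5928980944362008716807,
        8209769466447735689120, 19851462173893197019221, -67967248833175758026732,
        19231809737821516163109, -34478057947636763397399, 65725305030721455576699,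
        -113801122009598094025427, 178127016182329126964663],
      ![6312522067723791665395061245608089, -9326445088432419134335004963797669,
        -15410957167178092601967198551425065, -15708784114048510738742762101134232,
        -13265038891295012001774975693722438, -8869079112786251273613431868683261,
        1590945266173767583690471251395979, 4987724267600671167661549844928252,
        8606712697773174135665490676154955, 11308626447049751678971119700155903,
        10487854919914986594093447520084523]])
    (V' := ![
      ![131958956901, 47248614954, 28393605488, 13607644705, 771777106, -11953488587, 2562614478,
        8055087840, 14701925542, 23455674971, 35570826915],
      ![-421525639, 481335620, 130642800, -303943572, -79573858, 300493679, -85942094, -96321759,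
        139887303, 138788388, -314132611],
      ![-17739629159166999, 6509469402154306, 3341549949044619, 1165728566519465, 726867167391521,
        1838166195519675, 231486155718855, 405321206353045, -223526943043671, -1938518042025276,
        -4547851299015645],
      ![6478545770407721515771, 2325180661892235542656, 1407166327043685049547,
        675960463769009654263, 35311394247517725867, -592330826849012888157,
        125052439274380392194, 395981097924016995466, 728404642633857947126,
        1163714556931414611000, 1755604135175499713725],
      ![-4338580562106456633924122454109573511, -660183853139431385126763759643763230,
        1243965755435965036189943001090601962, 343160696113103350915871518636190538,
        -359847413776405589908805411573493205, -793730664212441829977595260827200852,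
        -72823740305181126150962532116310991, -477528449729877134462183429137541325,
        435786706955584277166123058512275106, 408929889869145570916888636669101289,
        896300861879955988074170640218315303]])
    (L := ![
      ![0, 2, 0, 2, 0, 1, 2, 0, 0, 2, 1],
      ![0, 1, 2, 1, 2, 1, 0, 2, 1, 1, 0],
      ![0, 2, 2, 0, 2, 0, 2, 1, 0, 0, 2],
      ![0, 1, 0, 2, 2, 2, 1, 0, 2, 1, 2],
      ![0, 1, 0, 2, 1, 2, 0, 0, 0, 2, 0]])
    (F := ![
      ![0, 1, 2, 0, 0, 1, 0, 0, 0, 0, 0],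
      ![0, 0, 0, 1, 0, 2, 0, 0, 0, 0, 0],
      ![0, 2, 2, 0, 0, 2, 0, 1, 0, 0, 0],
      ![0, 2, 2, 0, 0, 2, 0, 2, 0, 0, 0],
      ![0, 0, 1, 2, 1, 2, 0, 2, 0, 0, 0],
      ![0, 0, 0, 2, 2, 2, 0, 2, 0, 0, 0]])
    (by norm_num) (by norm_num) (by norm_num) (by norm_num) (by norm_num) (by norm_num)
    (by norm_num) (by decide) ?_ ?_ hS ht h
  · decide +kernel
  · decide +kernel

theorem eq_zero_of_thueForm_twenty_two {S t : ℤ} (hS : 3 ∣ S - 1) (ht : 3 ∣ t)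
    (h : thueForm 22 5 S t = 1) : t = 0 := by
  refine eq_zero_of_thueForm_eq_one (P := 22) (g := 13) (s := -1) (H := 4)
    (k := 7) (T := 1) (M := -7)
    (prog :=
      [false, true, false, true, false, false, false, true, false, true, false, false, true,
        false, false, true, false, false, true, false, false, false])
    (V := ![
      ![635601014, 354600322, 357506681, -292811404, -1349105893, -1145390158, -114845034,
        -197079498, 46621613, 435002370, 385303490],
      ![1187908777236, 436686006472, -250845089299, -998040417389, -594586239966, 1444959636551,
        792614554, 94589797223, 261276460974, 151039487212, -449495157722],
      ![611210101, 289430141, 359837791, 495250112, 713056041, 1055709059, -21150899, -66941443,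
        -124732925, -203269410, -317416781],
      ![-355004541813929451, 20973516363519775, -81086495813743282, 179758714995090709,
        -339818971229939676, 582948597661351011, 1091906381931418, 13134494862735580,
        -44094471302562132, 96308907479996702, -175078329767510508],
      ![-4654595510366, -1280646599108, 2889583389680, -2347726579561, -1640071742929,
        8136719925282, 413758619240, -616373535308, 480015081268, 608768654848, -2519240338615]])
    (V' := ![
      ![-7775206691416, -3686409571909, -4595744048105, -6303252500281, -9105489479580,
        -13489138448890, 269090773429, 854007136381, 1587244699168, 2596149792615, 4055945793024],
      ![224366, -259, 31802, 49896, -339369, 334495, -3767, -23840, -3364, 109177, -113471],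
      ![-630362509, 213736919, -285064427, -311551296, 622193514, 336024061, -30238585, 46650215,
        92387065, -173271111, -106056294],
      ![-1065181, -161991, 567838, -823680, 474977, 830582, -28510, -95982, 220950, -153370,
        -240736],
      ![-36369744401342696, -17244041741827383, -21497440733713956, -29484281398642934,
        -42592844669997558, -63098912312533296, 1258792250813167, 3994808837579305,
        7424502677872563, 12144028758175364, 18972749491508522]])
    (L := ![
      ![0, 1, 0, 1, 0, 1, 0, 1, 0, 1, 2],
      ![0, 0, 1, 1, 2, 0, 1, 0, 0, 2, 2],
      ![0, 2, 2, 2, 2, 1, 1, 1, 1, 0, 0],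
      ![0, 2, 0, 1, 0, 0, 0, 0, 1, 0, 0],
      ![0, 0, 2, 1, 2, 1, 1, 2, 0, 2, 0]])
    (F := ![
      ![0, 2, 1, 2, 0, 2, 0, 0, 0, 0, 0],
      ![0, 2, 0, 2, 2, 0, 0, 0, 0, 0, 0],
      ![0, 0, 2, 0, 1, 0, 0, 0, 0, 0, 0],
      ![0, 0, 1, 0, 1, 1, 0, 2, 0, 0, 0],
      ![0, 0, 0, 1, 1, 1, 0, 1, 0, 0, 0],
      ![0, 2, 1, 2, 0, 1, 0, 1, 0, 0, 0]])
    (by norm_num) (by norm_num) (by norm_num) (by norm_num) (by norm_num) (by norm_num)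
    (by norm_num) (by decide) ?_ ?_ hS ht h
  · decide +kernel
  · decide +kernel

theorem eq_zero_of_thueForm_twenty_six {S t : ℤ} (hS : 3 ∣ S - 1) (ht : 3 ∣ t)
    (h : thueForm 26 5 S t = 1) : t = 0 := by
  refine eq_zero_of_thueForm_eq_one (P := 26) (g := 15) (s := -1) (H := 4)
    (k := 7) (T := 1) (M := -10)
    (prog :=
      [false, true, false, true, false, false, false, true, false, true, false, false, true,
        false, false, true, false, false, true, false, false, false])
    (V := ![
      ![4657564, 5556385, 16679997, 7640447, -43075737, -73925000, -3429491, -7332049, -2643468,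
        12440999, 20623630],
      ![786120329, -113228748, 318271639, -606632791, 1029436552, -1622663658, 57769981,
        -88628956, 155386088, -266442176, 427650747],
      ![-37345654, 4164674, -12796338, 25926482, -45873345, 74575480, -1511186, 3023903, -6319524,
        11719795, -19604945],
      ![-5317066, 5233246, 3346025, -20100348, -2761750, 53057196, -3094650, -2108147, 6341399,
        1076354, -14766803],
      ![-468606472631726, 124524855601650, -272204096557466, -58986333139535, 622960337435292,
        -171694274805129, 7821192005638, 54495344536717, 2373185910118, -157997754420188,
        50077920923110]])
    (V' := ![
      ![5436774, -3002197, -5500261, -8488167, -8936133, -2288585, 604290, 1777351, 2692414,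
        2725021, 789485],
      ![-9738823791344088476, -4615938089379980732, -5848941590489604469, -8257855150206521020,
        -12326982747524408026, -18874408816591653372, 304984654410831404, 976270103476694137,
        1843831377293815310, 3082088755592141391, 4939989724639648743],
      ![-1754150239703624, 357177465796831, -1203526268883942, 331590660836273, 2612332531555080,
        -2209879296109705, 120049317136650, 281984364581135, -170683948640666, -673208138372890,
        624402236979104],
      ![-1980939225282331, 104511969638042, -430879579860410, 1006356343873607, -1999597663872616,
        3592676099611459, 15421180359577, 55727384706129, -215172656156277, 495388645840503,
        -938755215652434],
      ![-1017211809628938104691, -293474738797124607644, 654517508781342814040,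
        -492308265522749847235, -516755029003081154293, 2141253032535547865534,
        90867489703855851555, -126719223668832366291, 86176992877932503463, 158327784132115130863,
        -574952395691476815148]])
    (L := ![
      ![0, 1, 2, 0, 2, 1, 0, 2, 0, 2, 0],
      ![0, 0, 1, 1, 0, 1, 0, 1, 2, 2, 1],
      ![0, 0, 2, 2, 1, 2, 2, 0, 0, 1, 2],
      ![0, 2, 0, 2, 1, 2, 2, 0, 0, 0, 2],
      ![0, 0, 2, 1, 2, 1, 0, 2, 2, 2, 0]])
    (F := ![
      ![0, 2, 2, 2, 2, 2, 2, 0, 0, 0, 0],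
      ![0, 0, 0, 2, 0, 1, 0, 0, 0, 0, 0],
      ![0, 2, 2, 2, 0, 0, 2, 0, 0, 0, 0],
      ![0, 2, 1, 2, 1, 0, 0, 0, 0, 0, 0],
      ![0, 1, 2, 1, 2, 0, 2, 0, 0, 0, 0],
      ![0, 2, 2, 0, 1, 1, 1, 0, 0, 0, 0]])
    (by norm_num) (by norm_num) (by norm_num) (by norm_num) (by norm_num) (by norm_num)
    (by norm_num) (by decide) ?_ ?_ hS ht h
  · decide +kernel
  · decide +kernel

theorem eq_zero_of_thueForm_thirty_four {S t : ℤ} (hS : 3 ∣ S - 1) (ht : 3 ∣ t)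
    (h : thueForm 34 5 S t = 1) : t = 0 := by
  refine eq_zero_of_thueForm_eq_one (P := 34) (g := 1) (s := 1) (H := 2)
    (k := 5) (T := 18) (M := 10)
    (prog :=
      [false, true, false, true, false, false, false, true, false, true, false, false, true,
        false, false, true, false, false, true, false, false, false])
    (V := ![
      ![-2274674368244134355717469694631, -777318131061343967391328694966,
        -428656651858385926774358827638, -186770632966536376102002466396,
        8592089900065981615094920499, 206095043998673245189403017428,
        -30127008093722157453400998282, -97885457358449985048714761304,
        -190026509160428998301616957669, -329501873631889424907417411637,
        -551053916670887646586882752980],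
      ![-1183902036910376336753687361141, 892537444215611148215394977952,
        109901995998577472334308129663, -411102577486211287399700286232,
        -107456072660216496390547505031, 396526312870386603808200367956,
        -79905898522088044832268681365, -123435456858699673331489171854,
        155289686687285698817723745257, 259354023905910389880606242988,
        -494625321042111868801163640922],
      ![-611936432945475441555374911942911, -209067887713764633953859872918583,
        -115270780038454545249021943686013, -50243498925920740452625895234709,
        2280307251986100181119137785490, 55404526513325060722915434881128,
        -8112325109074472492250916014176, -26353582606125662706528584399106,
        -51139644846988627742808474835960, -88630882679504049974076086239130,
        -148199142856072331500565835736706],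
      ![70248528627698122828190099817008384921069, -26943033486086800691551054380368604874896,
        -15620615407122227048624778681257009433037, -7561947790805465231087530910758780798353,
        -5676360981714936242973369772893251899673, -9112975697050873916296317148635594612628,
        -330984245186605032726208010909837910199, -97422547599766964646596785857235203534,
        2735650884640519520516710751992508295612, 9342297133004031428761739456111112230386,
        19203722061627866735536343370415675047461],
      ![74324692165252821166740111395213785800949, -18078841530564704722827120741262394797504,
        11097113627861393330092566727837751065941, 3389411580884639045473032923657367246607,
        507098198388545258515526472948510344195, 9469693311478456516684868485614228552,
        -436852774798592030372068416406637806353, 2876334193135576065967588573507920997126,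
        2126839412134301365783105806114081989416, -10548774625516234781926882389837470282972,
        -1328640565140530698945876077563793990193]])
    (V' := ![
      ![-175879427149367853384104391, -22026236876504922374522411, 39345519349993872777100793,
        21154019917090445022327630, -18024236114743372818538940, -17432560012963457013004393,
        -6059659148647314471577743, -8299095781688929911469764, 10232098103359295824243578,
        32847829695381704309749062, 13574717388882115851791935],
      ![1622200367251132964987074616973319, -748679477809327343329139542727012,
        534981143530949232238703986516259, -338202596145577315855357489761759,
        156162441721580341093900754212431, 45517910488404800859552914242953,
        93178190588353244760651101183763, -81469891226783569675415868869002,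
        44200022179481298288672558654620, 49439426655903396550333874763537,
        -252884538991795540717987500651076],
      ![-5858947315696297704293506991161, -2805438742911444927081339171656,
        1423786133532869962672913971956, -842966244190317665626650666497,
        762930041368702776508165062640, -950006540269949028102451846299,
        455072581046797421985607474754, -614437732493768684856592545320,
        933934333809947900326019656992, -1397970966916696593167413755840,
        1934856146809004800036984939938],
      ![24265522456059366483126099436623145866394549,
        -29072907651309737289264884692722564522212395,
        -7363771659603368997319430842048672420358557,
        14793318975657370043153929843404637964469826, 3974346917498708770051588905659260420354554,
        -15199975836932813496055014798460453088401884,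
        3186546702691881633926902991657785946668426, 3913892975215328608558348084233921272163392,
        -6555678093258037324012568494667078760534943,
        -6944084506640545831802683468571658136402323,
        19334377406709963233654530833833328733318333],
      ![-1092269512963060209807938095160068442745811990230231,
        -380763836046528402488831148921925721074720083690881,
        -215182161010495050286769908973552142022119455267161,
        -89387805554960139223158150119222197578807668428876,
        3182648566759989504632975233090852820162590140598,
        103860627432423997736746457604165425195153222834106,
        -14355357743792066422803100123476995825492819364364,
        -49363567869480568902490989010410302541418095322028,
        -91940814053695193769792791618522989259236968007319,
        -161641827368280845762058341704703545818892093939951,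
        -276440863655655697618715428812559158759707410308573]])
    (L := ![
      ![0, 1, 0, 2, 2, 1, 2, 2, 2, 2, 2],
      ![0, 1, 0, 0, 0, 1, 2, 0, 1, 1, 0],
      ![0, 2, 1, 2, 1, 1, 0, 2, 2, 0, 2],
      ![0, 0, 1, 2, 1, 1, 0, 0, 0, 2, 0],
      ![0, 1, 1, 0, 2, 2, 2, 1, 2, 2, 2]])
    (F := ![
      ![0, 0, 1, 2, 1, 0, 0, 0, 0, 0, 0],
      ![0, 1, 1, 1, 0, 0, 0, 0, 2, 0, 0],
      ![0, 1, 1, 1, 2, 1, 0, 0, 2, 0, 0],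
      ![0, 2, 0, 2, 1, 1, 0, 0, 0, 0, 0],
      ![0, 0, 0, 1, 0, 2, 0, 0, 1, 0, 0],
      ![0, 1, 0, 1, 1, 0, 0, 0, 2, 0, 0]])
    (by norm_num) (by norm_num) (by norm_num) (by norm_num) (by norm_num) (by norm_num)
    (by norm_num) (by decide) ?_ ?_ hS ht h
  · decide +kernel
  · decide +kernel

theorem eq_zero_of_thueForm_thirty_eight {S t : ℤ} (hS : 3 ∣ S - 1) (ht : 3 ∣ t)
    (h : thueForm 38 5 S t = 1) : t = 0 := by
  refine eq_zero_of_thueForm_eq_one (P := 38) (g := 21) (s := -1) (H := 4)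
    (k := 7) (T := 1) (M := -22)
    (prog :=
      [false, true, false, true, false, false, false, true, false, true, false, false, true,
        false, false, true, false, false, true, false, false, false])
    (V := ![
      ![-10337544891, -1874918139, 6088536845, -8753378428, 3816012172, 15056026319, 9626497,
        -761965885, 1485678993, -725765495, -2821730114],
      ![-101432238945867131, 26334332587649675, -100824630039954242, -340349727415417146,
        -631738490048880418, -787479329364536071, 9357937413275700, 34715867906287610,
        75569906268547513, 125983894220474494, 152172730726530385],
      ![104947983352439, -24044408514553, 71780675976017, -11041076219054, -182256611507801,
        131409389803579, -3382997761630, -11726771671867, 4630031745166, 33781789432830,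
        -25891651632279],
      ![-127832612864987818075961, -60646036125830783349949, -80204571686550714815964,
        -121460793857810767434986, -195575636444644303118528, -322599577557648757034928,
        3151886622549174710341, 10308337026423067689263, 20253485324277472511630,
        35677779220115465391745, 60753989581368782839999],
      ![-22817685863336208194, -12039544734233135697, -12733060735097146433, 12047504217206486119,
        60635498522880048535, 53411098821705062059, 2248744739104567768, 3918352038201786783,
        -1574581179799309208, -11781579833770591871, -10575533106976985889]])
    (V' := ![
      ![126236022599, -2270475279, 17515112944, -54294137636, 132226807055, -278919146655,
        -3262871761, 98177616, 7764609467, -23548783111, 52346913203],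
      ![-775413897160453262651, -367878086349664719200, -486506928328945259403,
        -736779086122003878049, -1186375789500906365827, -1956848646620140794050,
        19118429571992801704, 62528066326203971759, 122857785448777095280, 216424072422998788024,
        368525900851030097269],
      ![-2016289592509973346, -127736301345614482, 123834348160209958, 231070243290494234,
        -1318584689302026794, 3753401786484366940, 149318521310875700, -115062377498476941,
        15863910572806864, 216375690507768207, -699229605093516957],
      ![-468687801611621679252806, 293060767232707348653219, 35080675945333185756106,
        -1086579702734075336147775, 201186509925143870787013, 3070770635828330260930899,
        -94959850083402429664168, -47635907677669445793414, 229101133742171247746748,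
        -27484912385558615012693, -597937524294907443291748],
      ![46764405977054626676823102075836717536176, 22185849852197709570363033589779242734533,
        29340830928991656557651059242373872787555, 44433394731831737982496641259471134529715,
        71546536524999981746572225269950304454485, 118015181705365095071066960459815816909814,
        -1153037267648057027707214635388716483867, -3771043278924534018762763468854587377659,
        -7409230622570402403946445111790352880798, -13051839079760651838242048614286772905871,
        -22225365003922665830333801692672306197218]])
    (L := ![
      ![0, 1, 2, 2, 1, 2, 2, 1, 1, 1, 1],
      ![0, 2, 0, 0, 2, 0, 2, 1, 0, 2, 0],
      ![0, 1, 0, 1, 1, 0, 1, 2, 1, 1, 0],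
      ![0, 2, 2, 0, 0, 1, 0, 2, 1, 0, 2],
      ![0, 1, 1, 0, 2, 2, 2, 1, 2, 0, 0]])
    (F := ![
      ![0, 0, 0, 2, 0, 2, 0, 0, 1, 0, 0],
      ![0, 0, 1, 2, 0, 0, 0, 0, 1, 0, 0],
      ![0, 2, 1, 2, 0, 1, 0, 0, 2, 0, 0],
      ![0, 0, 1, 1, 0, 1, 0, 0, 0, 0, 0],
      ![0, 1, 2, 0, 2, 1, 0, 0, 0, 0, 0],
      ![0, 1, 1, 0, 2, 2, 0, 0, 0, 0, 0]])
    (by norm_num) (by norm_num) (by norm_num) (by norm_num) (by norm_num) (by norm_num)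
    (by norm_num) (by decide) ?_ ?_ hS ht h
  · decide +kernel
  · decide +kernel

/-- A power identity with the trivial cofactor turns into a Thue equation. -/
theorem thueForm_eq_one_of_eq_mul_pow {D y y₀ s t : ℤ} (hDy : D = y₀ ^ 2 - 5)
    (h : (⟨y, 1⟩ : ℤ√D) = ⟨y₀, 1⟩ * ⟨s, t⟩ ^ 11) : thueForm (2 * y₀) 5 (s + y₀ * t) t = 1 := by
  have h' : (⟨y, -1⟩ : ℤ√D) = ⟨y₀, -1⟩ * ⟨s, -t⟩ ^ 11 := by
    simpa [starRingEnd_apply, Zsqrtd.star_mk] using congrArg (starRingEnd (ℤ√D)) h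
  have key := sub_mul_thueForm (⟨y₀, 1⟩ : ℤ√D) ⟨y₀, -1⟩ ((s + y₀ * t : ℤ) : ℤ√D) (t : ℤ)
  have e1 : ((s + y₀ * t : ℤ) : ℤ√D) - (t : ℤ) * ⟨y₀, -1⟩ = ⟨s, t⟩ := by
    ext
    · simp; ring
    · simp
  have e2 : ((s + y₀ * t : ℤ) : ℤ√D) - (t : ℤ) * ⟨y₀, 1⟩ = ⟨s, -t⟩ := by
    ext
    · simp; ring
    · simp
  have e3 : (⟨y₀, 1⟩ : ℤ√D) + ⟨y₀, -1⟩ = Int.castRingHom _ (2 * y₀) := by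
    ext <;> simp; ring
  have e4 : (⟨y₀, 1⟩ : ℤ√D) * ⟨y₀, -1⟩ = Int.castRingHom _ 5 := by
    ext <;> simp
    linarith
  rw [e1, e2, e3, e4, ← h, ← h', ← eq_intCast (Int.castRingHom (ℤ√D)) (s + y₀ * t),
    ← eq_intCast (Int.castRingHom (ℤ√D)) t, ← map_thueForm] at key
  have := congrArg Zsqrtd.im key
  simp at this
  linarith

/-- Eleventh power solutions of the companion equation in the residue class of the trivial
solution. -/
theorem eq_one_or_eq_neg_one_of_sq_eq {ℓ y₀ D P : ℤ} (hDℓ : D = 4 * ℓ) (hℓ : Prime ℓ)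
    (hDy : D = y₀ ^ 2 - 5) (hD : 0 < D) (hD400 : D < 400) (hD3 : (D : ZMod 3) ≠ 0)
    {W : List (ℤ × ℤ)} (hW : smallSplitCheck D W = true)
    {q k : ℕ} (hqp : q.Prime) (hq : q = 11 * k + 1) (hk : Even k) {c : ℤ}
    (hc : (c : ZMod q) * c = D) (hcy : (y₀ + c : ZMod q) ≠ 0) (e : Pell.Solution₁ D)
    (he : (e.x + e.y * c : ZMod q) ^ k ≠ 1) (hP : P = 2 * y₀)
    (hthue : ∀ S t : ℤ, 3 ∣ S - 1 → 3 ∣ t → thueForm P 5 S t = 1 → t = 0)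
    {x y : ℤ} (hx : Odd x) (hy : y ≡ y₀ [ZMOD (30 * q : ℕ)]) (h : y ^ 2 = 5 * x ^ 22 + D) :
    x = 1 ∨ x = -1 := by
  have : Fact q.Prime := ⟨hqp⟩
  have hx0 : x ≠ 0 := by
    rintro rfl
    simp at hx
  have hsq : ∀ r : ℤ, r ^ 2 ≠ D := by
    rintro r rfl
    have hr : Even r := (Int.even_pow.1 (hDℓ ▸ ⟨2 * ℓ, by ring⟩ : Even (r ^ 2))).1
    obtain ⟨r', rfl⟩ := hr
    exact hℓ.irreducible.not_isSquare ⟨r', by linarith⟩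
  have hmod : ∀ m : ℕ, m ∣ 30 * q → y ≡ y₀ [ZMOD m] := fun m hm ↦
    hy.of_dvd (Int.natCast_dvd_natCast.2 hm)
  have hcop : IsCoprime x (2 * y) := by
    refine IsCoprime.mul_right (Int.isCoprime_two_right.2 hx) ?_
    rw [Int.isCoprime_iff_gcd_eq_one]
    obtain ⟨g, hg⟩ : ∃ g : ℤ, g = Int.gcd x y := ⟨_, rfl⟩
    obtain ⟨x', hx'⟩ : g ∣ x := hg ▸ Int.gcd_dvd_left _ _
    obtain ⟨y', hy'⟩ : g ∣ y := hg ▸ Int.gcd_dvd_right _ _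
    have hgodd : IsCoprime g 2 := Int.isCoprime_two_right.2 (by
      rw [hx'] at hx
      exact (Int.odd_mul.1 hx).1)
    have hgD : g * g ∣ 2 ^ 2 * ℓ := by
      have : 2 ^ 2 * ℓ = g * g * (y' ^ 2 - 5 * g ^ 20 * x' ^ 22) := by
        have h0 : 2 ^ 2 * ℓ = y ^ 2 - 5 * x ^ 22 := by linarith
        rw [h0, hx', hy']
        ring
      exact ⟨_, this⟩
    have hgℓ : g * g ∣ ℓ :=
      (IsCoprime.mul_left hgodd hgodd).pow_right.dvd_of_dvd_mul_left hgD
    have := Int.isUnit_iff_natAbs_eq.1 (hℓ.squarefree g hgℓ)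
    simpa [hg] using this
  obtain ⟨s, t, hst, hs3, ht3⟩ := exists_eq_mul_pow_eleven hDy hD hsq
    (smallSplit_of_check hD400 hW) hx0 hcop (hmod 5 ⟨6 * q, by ring⟩) (hmod 3 ⟨10 * q, by ring⟩)
    hD3 hq hk (hmod q ⟨30, by ring⟩) hc hcy e he h
  have hT := thueForm_eq_one_of_eq_mul_pow hDy hst
  have ht : t = 0 := hthue (s + y₀ * t) t
    (by rw [add_sub_right_comm]; exact dvd_add hs3 (ht3.mul_left _)) ht3 (hP ▸ hT)
  subst ht
  have hs : s = 1 := by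
    have h11 : s ^ 11 = 1 := by simpa [thueForm] using hT
    exact (Odd.strictMono_pow (by decide : Odd 11)).injective (by simpa using h11)
  subst hs
  have hyy : y = y₀ := by
    have h1 : (⟨1, 0⟩ : ℤ√D) = 1 := rfl
    rw [h1, one_pow, mul_one] at hst
    exact congrArg Zsqrtd.re hst
  have hx22 : x ^ 22 = 1 := by
    rw [hyy, hDy] at h
    linarith
  exact (pow_eq_one_iff_of_ne_zero (by norm_num)).1 hx22 |>.imp id And.left

theorem eq_one_or_eq_neg_one_of_sq_eq_add_forty_four {x y : ℤ} (hx : Odd x)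
    (hy : y ≡ 7 [ZMOD (30 * 89 : ℕ)]) (h : y ^ 2 = 5 * x ^ 22 + 44) : x = 1 ∨ x = -1 := by
  exact eq_one_or_eq_neg_one_of_sq_eq (ℓ := 11) (by norm_num) (by norm_num) (by norm_num)
    (by norm_num) (by norm_num) (by decide)
    (W := [(7, 1), (-7, 1), (-20, 3), (-1, 0)])
    (by decide +kernel) (q := 89) (k := 8) (by norm_num) (by norm_num)
    (by decide) (c := 20) (by decide) (by decide)
    (Pell.Solution₁.mk 199 30 (by norm_num))
    (by simpa using by decide +kernel)
    (P := 14) (by norm_num) (fun S t ↦ eq_zero_of_thueForm_fourteen) hx hy h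

theorem eq_one_or_eq_neg_one_of_sq_eq_add_seventy_six {x y : ℤ} (hx : Odd x)
    (hy : y ≡ 9 [ZMOD (30 * 331 : ℕ)]) (h : y ^ 2 = 5 * x ^ 22 + 76) : x = 1 ∨ x = -1 := by
  exact eq_one_or_eq_neg_one_of_sq_eq (ℓ := 19) (by norm_num) (by norm_num) (by norm_num)
    (by norm_num) (by norm_num) (by decide)
    (W := [(26, 3), (-26, 3), (-9, 1), (9, 1), (-340, 39), (-61, 7), (61, 7), (-1, 0)])
    (by decide +kernel) (q := 331) (k := 30) (by norm_num) (by norm_num)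
    (by decide) (c := 71) (by decide) (by decide)
    (Pell.Solution₁.mk 57799 6630 (by norm_num))
    (by simpa using by decide +kernel)
    (P := 18) (by norm_num) (fun S t ↦ eq_zero_of_thueForm_eighteen) hx hy h

theorem eq_one_or_eq_neg_one_of_sq_eq_add_one_hundred_sixteen {x y : ℤ} (hx : Odd x)
    (hy : y ≡ 11 [ZMOD (30 * 199 : ℕ)]) (h : y ^ 2 = 5 * x ^ 22 + 116) : x = 1 ∨ x = -1 := by
  exact eq_one_or_eq_neg_one_of_sq_eq (ℓ := 29) (by norm_num) (by norm_num) (by norm_num)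
    (by norm_num) (by norm_num) (by decide)
    (W := [(-43, 4), (43, 4), (11, 1), (-11, 1), (-140, 13), (-1, 0)])
    (by decide +kernel) (q := 199) (k := 18) (by norm_num) (by norm_num)
    (by decide) (c := 64) (by decide) (by decide)
    (Pell.Solution₁.mk 9801 910 (by norm_num))
    (by simpa using by decide +kernel)
    (P := 22) (by norm_num) (fun S t ↦ eq_zero_of_thueForm_twenty_two) hx hy h

theorem eq_one_or_eq_neg_one_of_sq_eq_add_one_hundred_sixty_four {x y : ℤ} (hx : Odd x)
    (hy : y ≡ 13 [ZMOD (30 * 661 : ℕ)]) (h : y ^ 2 = 5 * x ^ 22 + 164) : x = 1 ∨ x = -1 := by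
  exact eq_one_or_eq_neg_one_of_sq_eq (ℓ := 41) (by norm_num) (by norm_num) (by norm_num)
    (by norm_num) (by norm_num) (by decide)
    (W := [(-13, 1), (13, 1), (-64, 5), (-1, 0)])
    (by decide +kernel) (q := 661) (k := 60) (by norm_num) (by norm_num)
    (by decide) (c := 146) (by decide) (by decide)
    (Pell.Solution₁.mk 2049 160 (by norm_num))
    (by simpa using by decide +kernel)
    (P := 26) (by norm_num) (fun S t ↦ eq_zero_of_thueForm_twenty_six) hx hy h

theorem eq_one_or_eq_neg_one_of_sq_eq_add_two_hundred_eighty_four {x y : ℤ} (hx : Odd x)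
    (hy : y ≡ 17 [ZMOD (30 * 331 : ℕ)]) (h : y ^ 2 = 5 * x ^ 22 + 284) : x = 1 ∨ x = -1 := by
  exact eq_one_or_eq_neg_one_of_sq_eq (ℓ := 71) (by norm_num) (by norm_num) (by norm_num)
    (by norm_num) (by norm_num) (by decide)
    (W := [(455, 27), (-455, 27), (-118, 7), (118, 7), (1483, 88), (-1483, 88), (17, 1), (-17, 1),
      (-6960, 413), (-1, 0)])
    (by decide +kernel) (q := 331) (k := 30) (by norm_num) (by norm_num)
    (by decide) (c := 51) (by decide) (by decide)
    (Pell.Solution₁.mk 24220799 1437240 (by norm_num))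
    (by simpa using by decide +kernel)
    (P := 34) (by norm_num) (fun S t ↦ eq_zero_of_thueForm_thirty_four) hx hy h

theorem eq_one_or_eq_neg_one_of_sq_eq_add_three_hundred_fifty_six {x y : ℤ} (hx : Odd x)
    (hy : y ≡ 19 [ZMOD (30 * 199 : ℕ)]) (h : y ^ 2 = 5 * x ^ 22 + 356) : x = 1 ∨ x = -1 := by
  exact eq_one_or_eq_neg_one_of_sq_eq (ℓ := 89) (by norm_num) (by norm_num) (by norm_num)
    (by norm_num) (by norm_num) (by decide)
    (W := [(-151, 8), (151, 8), (283, 15), (-283, 15), (-19, 1), (19, 1), (-1000, 53), (-1, 0)])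
    (by decide +kernel) (q := 199) (k := 18) (by norm_num) (by norm_num)
    (by decide) (c := 82) (by decide) (by decide)
    (Pell.Solution₁.mk 500001 26500 (by norm_num))
    (by simpa using by decide +kernel)
    (P := 38) (by norm_num) (fun S t ↦ eq_zero_of_thueForm_thirty_eight) hx hy h

/-- The sieve and the companion equation combined: `Q`, `qs`, `s` are the data for the sieve modulo
`1320`, and `r` is the state of the recursion modulo `N` at the surviving index `n₀`. -/
theorem eq_one_or_eq_neg_one_of_hardSeq {D y₀ a b : ℤ} {Q N n₀ : ℕ} {qs : List ℕ} {s r : ℕ × ℕ}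
    (hmain : ∀ x y : ℤ, Odd x → y ≡ y₀ [ZMOD N] → y ^ 2 = 5 * x ^ 22 + D → x = 1 ∨ x = -1)
    (hqs : ∀ q ∈ qs, q.Prime ∧ q % 11 = 1 ∧ q ∣ Q) {s' : ℕ × ℕ}
    (h0 : (s.1 : ℤ) ≡ 2 * b [ZMOD Q]) (h1 : (s.2 : ℤ) ≡ a + b [ZMOD Q])
    (hrun : sieveRun Q qs n₀ s 2640 0 s = true)
    (h0' : (s'.1 : ℤ) ≡ 2 * b [ZMOD N]) (h1' : (s'.2 : ℤ) ≡ a + b [ZMOD N])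
    (hper : (fibStep N)^[1320] s' = s') (hr : (fibStep N)^[n₀] s' = r) (hN : 2 ∣ N)
    (hr1 : Odd r.1) (ε : ℤˣ) (hr2 : ε * (2 * r.2 - r.1) ≡ y₀ [ZMOD N])
    (hD : 4 * ((-1) ^ n₀ * (a ^ 2 - 5 * b ^ 2)) = D) {n : ℕ} {x : ℤ}
    (hx : hardSeq a b n = x ^ 11) : x = 1 ∨ x = -1 := by
  have hn := index_of_sieve hqs h0 h1 hrun hx
  obtain ⟨hw, hw'⟩ := hardSeq_modEq_of_mod h0' h1' hper hr hn
  refine hmain x (ε * (2 * hardSeq a b (n + 1) - hardSeq a b n)) ?_ ?_ ?_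
  · have h2 : (r.1 : ℤ) % 2 = hardSeq a b n % 2 := hw.of_dvd (by exact_mod_cast hN)
    rw [hx] at h2
    refine (Int.odd_pow' (n := 11) (by norm_num)).1 (Int.odd_iff.2 ?_)
    rw [← h2]
    exact Int.odd_iff.1 (by exact_mod_cast hr1)
  · exact (((hw'.symm.mul_left 2).sub hw.symm).mul_left _).trans hr2
  · have hpar : (-1 : ℤ) ^ n = (-1) ^ n₀ := by
      rw [neg_one_pow_eq_pow_mod_two, neg_one_pow_eq_pow_mod_two (n := n₀), ← hn,
        Nat.mod_mod_of_dvd n (by norm_num)]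
    have hε : (ε : ℤ) ^ 2 = 1 := by rw [← Units.val_pow_eq_pow_val, Int.units_sq, Units.val_one]
    rw [mul_pow, hε, one_mul, hardSeq_companion, hpar, hD, hx, ← pow_mul]

theorem no_eleventh_powers_in_hard_sequences (a b : ℤ)
    (hab : (a, b) ∈ ({(1, 2), (1, -2), (4, 1), (4, -1), (4, 3), (4, -3),
      (11, 4), (11, -4), (14, 5), (14, -5), (6, 5), (6, -5)} : Set (ℤ × ℤ)))
    (n : ℕ) (x : ℤ) (h : a * fibZ n + b * lucasZ n = x ^ 11) :
    x = 1 ∨ x = -1 := by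
  change hardSeq a b n = x ^ 11 at h
  simp only [Set.mem_insert_iff, Set.mem_singleton_iff, Prod.mk.injEq] at hab
  rcases hab with ⟨rfl, rfl⟩ | ⟨rfl, rfl⟩ | ⟨rfl, rfl⟩ | ⟨rfl, rfl⟩ | ⟨rfl, rfl⟩ | ⟨rfl, rfl⟩ |
    ⟨rfl, rfl⟩ | ⟨rfl, rfl⟩ | ⟨rfl, rfl⟩ | ⟨rfl, rfl⟩ | ⟨rfl, rfl⟩ | ⟨rfl, rfl⟩
  · exact eq_one_or_eq_neg_one_of_hardSeq (Q := 118788615683) (N := 30 * 331) (n₀ := 1319)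
      (qs := [23, 89, 199, 331, 881]) (s := (4, 3)) (s' := (4, 3))
      (r := (9929, 4)) (fun _ _ ↦ eq_one_or_eq_neg_one_of_sq_eq_add_seventy_six)
      (by norm_num) (by decide) (by decide) (by decide +kernel) (by decide) (by decide)
      (by decide +kernel) (by decide +kernel) (by norm_num) (by decide) 1 (by decide)
      (by norm_num) h
  · exact eq_one_or_eq_neg_one_of_hardSeq (Q := 118788615683) (N := 30 * 331) (n₀ := 1)
      (qs := [23, 89, 199, 331, 881]) (s := (118788615679, 118788615682)) (s' := (9926, 9929))
      (r := (9929, 9925)) (fun _ _ ↦ eq_one_or_eq_neg_one_of_sq_eq_add_seventy_six)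
      (by norm_num) (by decide) (by decide) (by decide +kernel) (by decide) (by decide)
      (by decide +kernel) (by decide +kernel) (by norm_num) (by decide) (-1) (by decide)
      (by norm_num) h
  · exact eq_one_or_eq_neg_one_of_hardSeq (Q := 78519274966463) (N := 30 * 89) (n₀ := 1318)
      (qs := [23, 89, 199, 331, 661, 881]) (s := (2, 5)) (s' := (2, 5))
      (r := (2669, 3)) (fun _ _ ↦ eq_one_or_eq_neg_one_of_sq_eq_add_forty_four)
      (by norm_num) (by decide) (by decide) (by decide +kernel) (by decide) (by decide)
      (by decide +kernel) (by decide +kernel) (by norm_num) (by decide) 1 (by decide)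
      (by norm_num) h
  · exact eq_one_or_eq_neg_one_of_hardSeq (Q := 78519274966463) (N := 30 * 89) (n₀ := 2)
      (qs := [23, 89, 199, 331, 661, 881]) (s := (78519274966461, 3)) (s' := (2668, 3))
      (r := (1, 4)) (fun _ _ ↦ eq_one_or_eq_neg_one_of_sq_eq_add_forty_four)
      (by norm_num) (by decide) (by decide) (by decide +kernel) (by decide) (by decide)
      (by decide +kernel) (by decide +kernel) (by norm_num) (by decide) 1 (by decide)
      (by norm_num) h
  · exact eq_one_or_eq_neg_one_of_hardSeq (Q := 1763521630876303) (N := 30 * 199) (n₀ := 1319)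
      (qs := [23, 89, 199, 331, 1321, 9901]) (s := (6, 7)) (s' := (6, 7))
      (r := (1, 6)) (fun _ _ ↦ eq_one_or_eq_neg_one_of_sq_eq_add_one_hundred_sixteen)
      (by norm_num) (by decide) (by decide) (by decide +kernel) (by decide) (by decide)
      (by decide +kernel) (by decide +kernel) (by norm_num) (by decide) 1 (by decide)
      (by norm_num) h
  · exact eq_one_or_eq_neg_one_of_hardSeq (Q := 1763521630876303) (N := 30 * 199) (n₀ := 1)
      (qs := [23, 89, 199, 331, 1321, 9901]) (s := (1763521630876297, 1)) (s' := (5964, 1))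
      (r := (1, 5965)) (fun _ _ ↦ eq_one_or_eq_neg_one_of_sq_eq_add_one_hundred_sixteen)
      (by norm_num) (by decide) (by decide) (by decide +kernel) (by decide) (by decide)
      (by decide +kernel) (by decide +kernel) (by norm_num) (by decide) (-1) (by decide)
      (by norm_num) h
  · exact eq_one_or_eq_neg_one_of_hardSeq (Q := 828693259516360283) (N := 30 * 661) (n₀ := 1318)
      (qs := [23, 89, 199, 331, 881, 1321, 5281]) (s := (8, 15)) (s' := (8, 15))
      (r := (1, 7)) (fun _ _ ↦ eq_one_or_eq_neg_one_of_sq_eq_add_one_hundred_sixty_four)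
      (by norm_num) (by decide) (by decide) (by decide +kernel) (by decide) (by decide)
      (by decide +kernel) (by decide +kernel) (by norm_num) (by decide) 1 (by decide)
      (by norm_num) h
  · exact eq_one_or_eq_neg_one_of_hardSeq (Q := 828693259516360283) (N := 30 * 661) (n₀ := 2)
      (qs := [23, 89, 199, 331, 881, 1321, 5281]) (s := (828693259516360275, 7)) (s' := (19822, 7))
      (r := (19829, 6)) (fun _ _ ↦ eq_one_or_eq_neg_one_of_sq_eq_add_one_hundred_sixty_four)
      (by norm_num) (by decide) (by decide) (by decide +kernel) (by decide) (by decide)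
      (by decide +kernel) (by decide +kernel) (by norm_num) (by decide) 1 (by decide)
      (by norm_num) h
  · exact eq_one_or_eq_neg_one_of_hardSeq (Q := 118788615683) (N := 30 * 331) (n₀ := 1318)
      (qs := [23, 89, 199, 331, 881]) (s := (10, 19)) (s' := (10, 19))
      (r := (1, 9)) (fun _ _ ↦ eq_one_or_eq_neg_one_of_sq_eq_add_two_hundred_eighty_four)
      (by norm_num) (by decide) (by decide) (by decide +kernel) (by decide) (by decide)
      (by decide +kernel) (by decide +kernel) (by norm_num) (by decide) 1 (by decide)
      (by norm_num) h
  · exact eq_one_or_eq_neg_one_of_hardSeq (Q := 118788615683) (N := 30 * 331) (n₀ := 2)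
      (qs := [23, 89, 199, 331, 881]) (s := (118788615673, 9)) (s' := (9920, 9))
      (r := (9929, 8)) (fun _ _ ↦ eq_one_or_eq_neg_one_of_sq_eq_add_two_hundred_eighty_four)
      (by norm_num) (by decide) (by decide) (by decide +kernel) (by decide) (by decide)
      (by decide +kernel) (by decide +kernel) (by norm_num) (by decide) 1 (by decide)
      (by norm_num) h
  · exact eq_one_or_eq_neg_one_of_hardSeq (Q := 78519274966463) (N := 30 * 199) (n₀ := 1319)
      (qs := [23, 89, 199, 331, 661, 881]) (s := (10, 11)) (s' := (10, 11))
      (r := (1, 10)) (fun _ _ ↦ eq_one_or_eq_neg_one_of_sq_eq_add_three_hundred_fifty_six)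
      (by norm_num) (by decide) (by decide) (by decide +kernel) (by decide) (by decide)
      (by decide +kernel) (by decide +kernel) (by norm_num) (by decide) 1 (by decide)
      (by norm_num) h
  · exact eq_one_or_eq_neg_one_of_hardSeq (Q := 78519274966463) (N := 30 * 199) (n₀ := 1)
      (qs := [23, 89, 199, 331, 661, 881]) (s := (78519274966453, 1)) (s' := (5960, 1))
      (r := (1, 5961)) (fun _ _ ↦ eq_one_or_eq_neg_one_of_sq_eq_add_three_hundred_fifty_six)
      (by norm_num) (by decide) (by decide) (by decide +kernel) (by decide) (by decide)
      (by decide +kernel) (by decide +kernel) (by norm_num) (by decide) (-1) (by decide)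
      (by norm_num) h
end
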